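/- Let S ⊂ ℂⁿ be a compact connected simply-connected smooth real hypersurface bounding a domain Ω. A smooth function u: S → ℂ extends to a smooth function on the closure of Ω that is pluriharmonic in Ω if and only if u is the sum of a CR function and a conjugate-CR function on S. -/

import Mathlib

open Complex ComplexConjugate

noncomputable def wirt {n : ℕ} (j : Fin n) (f : (Fin n → ℂ) → ℂ) (x : Fin n → ℂ) : ℂ :=
  (fderiv ℝ f x (Pi.single j 1) - Complex.I * fderiv ℝ f x (Pi.single j Complex.I)) / 2

noncomputable def wirtBar {n : ℕ} (j : Fin n) (f : (Fin n → ℂ) → ℂ) (x : Fin n → ℂ) : ℂ :=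
  (fderiv ℝ f x (Pi.single j 1) + Complex.I * fderiv ℝ f x (Pi.single j Complex.I)) / 2

/-- A smooth (ambient) function `f` is CR on `S = {ρ = 0}` if every complexified
tangent vector of type (0,1) annihilates it. -/
def IsCROn {n : ℕ} (ρ : (Fin n → ℂ) → ℝ) (S : Set (Fin n → ℂ))
    (f : (Fin n → ℂ) → ℂ) : Prop :=
  ∀ x ∈ S, ∀ a : Fin n → ℂ,
    (∑ j, a j * wirtBar j (fun y => (ρ y : ℂ)) x = 0) →
    ∑ j, a j * wirtBar j f x = 0

section RealHypersurface
open Set Filter Topology Metric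
open scoped ContDiff
variable {E : Type*} [NormedAddCommGroup E] [NormedSpace ℝ E] [FiniteDimensional ℝ E]

theorem exists_straightening {ρ : E → ℝ} (hρ : ContDiff ℝ ∞ ρ) {p : E}
    (hp : fderiv ℝ ρ p ≠ 0) :
    ∃ (e : E) (ℓ : E →L[ℝ] ℝ) (Φ : OpenPartialHomeomorph E E), ℓ e = 1 ∧ p ∈ Φ.source ∧
      ContDiff ℝ ∞ Φ ∧ ContDiffOn ℝ ∞ Φ.symm Φ.target ∧ ∀ x, ℓ (Φ x) = ρ x := by
  have := FiniteDimensional.complete ℝ E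
  obtain ⟨v, hv⟩ : ∃ v, fderiv ℝ ρ p v ≠ 0 := by
    by_contra! h
    exact hp (ContinuousLinearMap.ext h)
  set ℓ := fderiv ℝ ρ p with hℓ
  set e : E := (ℓ v)⁻¹ • v with he
  have hℓe : ℓ e = 1 := by simp [he, hv]
  set f : E → E := fun x => x + (ρ x - ℓ x) • e with hf
  have hfs : ContDiff ℝ ∞ f :=
    contDiff_id.add ((hρ.sub ℓ.contDiff).smul contDiff_const)
  have hfd : HasFDerivAt f ((ContinuousLinearEquiv.refl ℝ E : E ≃L[ℝ] E) : E →L[ℝ] E) p := by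
    have h1 : HasFDerivAt ρ ℓ p := (hρ.differentiable (by simp) p).hasFDerivAt
    have h2 := (hasFDerivAt_id p).add ((h1.sub ℓ.hasFDerivAt).smul_const e)
    refine h2.congr_fderiv ?_
    ext x
    simp
  set Φ₀ := hfs.contDiffAt.toOpenPartialHomeomorph f hfd (by simp) with hΦ₀
  have hW : IsOpen {x | fderiv ℝ f x ∈ range ((↑) : (E ≃L[ℝ] E) → E →L[ℝ] E)} :=
    ContinuousLinearEquiv.isOpen.preimage (hfs.continuous_fderiv (by simp))
  have hcoe : (Φ₀ : E → E) = f := rfl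
  refine ⟨e, ℓ, Φ₀.restrOpen _ hW, hℓe, ?_, ?_, ?_, ?_⟩
  · refine ⟨hfs.contDiffAt.mem_toOpenPartialHomeomorph_source hfd (by simp), ?_⟩
    exact ⟨_, hfd.fderiv.symm⟩
  · exact hfs
  · intro y hy
    have hy' := (Φ₀.restrOpen _ hW).map_target hy
    obtain ⟨_, A, hA⟩ := hy'
    refine (OpenPartialHomeomorph.contDiffAt_symm (n := ∞) (Φ₀.restrOpen _ hW) (f₀' := A) hy ?_
      hfs.contDiffAt).contDiffWithinAt
    rw [hA]
    exact (hfs.differentiable (by simp) _).hasFDerivAt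
  · intro x
    change ℓ (f x) = ρ x
    simp [hf, hℓe]

theorem exists_smooth_retraction {ρ : E → ℝ} (hρ : ContDiff ℝ ∞ ρ) {p : E}
    (hp₀ : ρ p = 0) (hp : fderiv ℝ ρ p ≠ 0) :
    ∃ ε > 0, ∃ r : E → E, ContDiffOn ℝ ∞ r (ball p ε) ∧ (∀ x ∈ ball p ε, ρ (r x) = 0) ∧
      (∀ x ∈ ball p ε, ρ x = 0 → r x = x) ∧ ∀ v, fderiv ℝ ρ p v = 0 → fderiv ℝ r p v = v := by
  obtain ⟨e, ℓ, Φ, hℓe, hpΦ, hΦ, hΦs, hℓ⟩ := exists_straightening hρ hp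
  set g : E → E := fun x => Φ x - ρ x • e with hg
  have hgs : ContDiff ℝ ∞ g := hΦ.sub (hρ.smul contDiff_const)
  have hgp : g p = Φ p := by simp [hg, hp₀]
  have hopen : IsOpen (Φ.source ∩ g ⁻¹' Φ.target) :=
    Φ.open_source.inter (Φ.open_target.preimage hgs.continuous)
  obtain ⟨ε, hε, hball⟩ := Metric.isOpen_iff.1 hopen p ⟨hpΦ, by
    rw [mem_preimage, hgp]; exact Φ.map_source hpΦ⟩
  refine ⟨ε, hε, Φ.symm ∘ g, ?_, ?_, ?_, ?_⟩
  · exact hΦs.comp hgs.contDiffOn fun x hx => (hball hx).2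
  · intro x hx
    rw [← hℓ, Function.comp_apply, Φ.right_inv (hball hx).2]
    simp [hg, hℓ, hℓe]
  · intro x hx h0
    simp [hg, h0, Φ.left_inv (hball hx).1]
  · intro v hv
    have hd : DifferentiableAt ℝ Φ.symm (Φ p) :=
      (hΦs.contDiffAt (Φ.open_target.mem_nhds (Φ.map_source hpΦ))).differentiableAt (by simp)
    have hd' : DifferentiableAt ℝ Φ.symm (g p) := by rwa [hgp]
    have hΦd : DifferentiableAt ℝ Φ p := hΦ.differentiable (by simp) p
    have hgd : fderiv ℝ g p v = fderiv ℝ Φ p v := by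
      have h1 : HasFDerivAt g _ p := hΦd.hasFDerivAt.sub
        (((hρ.differentiable (by simp) p).hasFDerivAt).smul_const e)
      rw [h1.fderiv]
      simp [hv]
    rw [fderiv_comp p hd' (hgs.differentiable (by simp) p), ContinuousLinearMap.comp_apply, hgd,
      hgp, ← ContinuousLinearMap.comp_apply, ← fderiv_comp p hd hΦd]
    have : Φ.symm ∘ Φ =ᶠ[𝓝 p] id := by
      filter_upwards [Φ.open_source.mem_nhds hpΦ] with x hx
      exact Φ.left_inv hx
    rw [this.fderiv_eq]
    simp

/-- The derivative of a function vanishing on a regular level set kills tangent vectors. -/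
theorem fderiv_eq_zero_of_tangent {F : Type*} [NormedAddCommGroup F] [NormedSpace ℝ F]
    {ρ : E → ℝ} (hρ : ContDiff ℝ ∞ ρ) {p : E} (hp₀ : ρ p = 0) (hp : fderiv ℝ ρ p ≠ 0)
    {w : E → F} (hw : DifferentiableAt ℝ w p) (hw₀ : ∀ᶠ x in 𝓝 p, ρ x = 0 → w x = 0)
    {v : E} (hv : fderiv ℝ ρ p v = 0) : fderiv ℝ w p v = 0 := by
  obtain ⟨ε, hε, r, hr, hr₀, hrid, hrv⟩ := exists_smooth_retraction hρ hp₀ hp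
  have hpb : ball p ε ∈ 𝓝 p := ball_mem_nhds p hε
  have hrp : r p = p := hrid p (mem_ball_self hε) hp₀
  have hrd : DifferentiableAt ℝ r p := (hr.contDiffAt hpb).differentiableAt (by simp)
  have hz : w ∘ r =ᶠ[𝓝 p] fun _ => 0 := by
    have ht : Tendsto r (𝓝 p) (𝓝 p) := by
      have := hrd.continuousAt.tendsto
      rwa [hrp] at this
    filter_upwards [hpb, ht.eventually hw₀] with x hx hx'
    exact hx' (hr₀ x hx)
  have h1 : fderiv ℝ (w ∘ r) p v = fderiv ℝ w p v := by
    rw [fderiv_comp p (by rwa [hrp]) hrd, ContinuousLinearMap.comp_apply, hrv v hv, hrp]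
  rw [← h1, hz.fderiv_eq]
  simp

/-- Locally defined smooth functions agreeing with `φ` on a set glue to a global smooth function. -/
theorem exists_contDiff_forall_mem_convex_of_local {F : Type*} [NormedAddCommGroup F]
    [NormedSpace ℝ F] {t : E → Set F} (ht : ∀ x, Convex ℝ (t x))
    (h : ∀ x, ∃ U ∈ 𝓝 x, ∃ g : E → F, ContDiffOn ℝ ∞ g U ∧ ∀ y ∈ U, g y ∈ t y) :
    ∃ g : E → F, ContDiff ℝ ∞ g ∧ ∀ x, g x ∈ t x := by
  obtain ⟨g, hg⟩ := exists_contMDiffMap_forall_mem_convex_of_local (n := (⊤ : ℕ∞))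
    (modelWithCornersSelf ℝ E) ht fun x => by
      obtain ⟨U, hU, g, hg, hgt⟩ := h x
      exact ⟨U, hU, g, hg.contMDiffOn, hgt⟩
  exact ⟨g, g.contMDiff.contDiff, hg⟩

end RealHypersurface

section HadamardDivision
open Set Filter Topology Metric MeasureTheory
open scoped ContDiff Convolution
variable {E : Type*} [NormedAddCommGroup E] [NormedSpace ℝ E]
variable {F : Type*} [NormedAddCommGroup F] [NormedSpace ℝ F] [CompleteSpace F]

theorem exists_eq_smul_of_eq_zero_on_ker {G : E → F} (hG : ContDiff ℝ ∞ G) {ℓ : E →L[ℝ] ℝ} {e : E}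
    (he : ℓ e = 1) (hG₀ : ∀ y, ℓ y = 0 → G y = 0) :
    ∃ K : E → F, ContDiff ℝ ∞ K ∧ ∀ y, G y = ℓ y • K y := by
  let β : ContDiffBump (0 : ℝ) := ⟨2, 3, by norm_num, by norm_num⟩
  let f : ℝ → ℝ := indicator (Icc 0 1) fun _ => 1
  let g : E → ℝ → F := fun p x => β x • fderiv ℝ G (p + (x * ℓ p) • e) e
  have hDG : ContDiff ℝ ∞ (fderiv ℝ G) := hG.fderiv_right (by simp)
  have hg : ContDiff ℝ ∞ (Function.uncurry g) := by
    refine (β.contDiff.comp contDiff_snd).smul ((hDG.comp ?_).clm_apply contDiff_const)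
    exact contDiff_fst.add
      ((contDiff_snd.mul (ℓ.contDiff.comp contDiff_fst)).smul contDiff_const)
  have hf : LocallyIntegrable f volume := by
    refine Integrable.locallyIntegrable ?_
    exact (integrable_indicator_iff measurableSet_Icc).2 (by simp)
  have hK := contDiffOn_convolution_right_with_param_comp (n := (⊤ : ℕ∞)) (μ := volume)
    (ContinuousLinearMap.lsmul ℝ ℝ : ℝ →L[ℝ] F →L[ℝ] F)
    (s := univ) (v := fun _ : E => (0 : ℝ)) contDiffOn_const (f := f) (g := g)
    (k := closedBall 0 3) isOpen_univ (isCompact_closedBall _ _) (fun p x _ hx => by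
      have : β x = 0 := β.zero_of_le_dist (by
        simp only [mem_closedBall, not_le] at hx
        exact hx.le)
      simp [g, this]) hf hg.contDiffOn
  refine ⟨_, contDiffOn_univ.1 hK, fun y => ?_⟩
  have h1 : (f ⋆[ContinuousLinearMap.lsmul ℝ ℝ, volume] g y) 0
      = ∫ s in (0 : ℝ)..1, fderiv ℝ G (y - (s * ℓ y) • e) e := by
    rw [convolution_def, intervalIntegral.integral_of_le zero_le_one, ← integral_Icc_eq_integral_Ioc,
      ← integral_indicator measurableSet_Icc]
    congr 1
    ext t
    by_cases ht : t ∈ Icc (0 : ℝ) 1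
    · have : β (-t) = 1 := β.one_of_mem_closedBall (by
        simp only [mem_closedBall, dist_zero_right, norm_neg, Real.norm_eq_abs]
        rw [abs_of_nonneg ht.1]
        exact ht.2.trans (by norm_num [β]))
      simp [f, g, ht, this, sub_eq_add_neg]
    · simp [f, ht]
  have h2 : ∀ s : ℝ, HasDerivAt (fun s : ℝ => G (y - (s * ℓ y) • e))
      (-(ℓ y • fderiv ℝ G (y - (s * ℓ y) • e) e)) s := by
    intro s
    have h3 : HasDerivAt (fun s : ℝ => y - (s * ℓ y) • e) (-(ℓ y • e)) s := by
      simpa using (((hasDerivAt_id s).mul_const (ℓ y)).smul_const e).const_sub y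
    have h4 := ((hG.differentiable (by simp) (y - (s * ℓ y) • e)).hasFDerivAt).comp_hasDerivAt s h3
    simpa using! h4
  have hc : Continuous fun s : ℝ => fderiv ℝ G (y - (s * ℓ y) • e) e := by
    have := hDG.continuous
    fun_prop
  have h5 := intervalIntegral.integral_eq_sub_of_hasDerivAt (a := 0) (b := 1)
    (fun s _ => h2 s) ((hc.const_smul (ℓ y)).neg.intervalIntegrable _ _)
  rw [intervalIntegral.integral_neg, intervalIntegral.integral_smul] at h5
  have h6 : G (y - (1 * ℓ y) • e) = 0 := hG₀ _ (by simp [he])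
  rw [h6] at h5
  simp only [zero_mul, zero_smul, sub_zero, zero_sub, neg_inj] at h5
  rw [h1, h5]

variable [FiniteDimensional ℝ E]

/-- **Hadamard's lemma**: a smooth function vanishing on a regular level set `{ρ = 0}` is
divisible by `ρ`. -/
theorem exists_contDiff_eq_smul {ρ : E → ℝ} (hρ : ContDiff ℝ ∞ ρ)
    (hreg : ∀ x, ρ x = 0 → fderiv ℝ ρ x ≠ 0) {w : E → F} (hw : ContDiff ℝ ∞ w)
    (hw₀ : ∀ x, ρ x = 0 → w x = 0) :
    ∃ θ : E → F, ContDiff ℝ ∞ θ ∧ ∀ x, w x = ρ x • θ x := by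
  refine exists_contDiff_forall_mem_convex_of_local (t := fun x => {y | w x = ρ x • y}) ?_ ?_
  · intro x y hy z hz a b _ _ hab
    simp only [mem_ofPred_eq] at hy hz ⊢
    rw [smul_add, smul_comm _ a, smul_comm _ b, ← hy, ← hz, ← add_smul, hab, one_smul]
  intro p
  by_cases hp : ρ p = 0
  · obtain ⟨e, ℓ, Φ, hℓe, hpΦ, hΦ, hΦs, hℓ⟩ := exists_straightening hρ (hreg p hp)
    obtain ⟨ε, hε, hball⟩ := Metric.isOpen_iff.1 Φ.open_target _ (Φ.map_source hpΦ)
    let χ : ContDiffBump (Φ p) := ⟨ε / 3, ε / 2, by positivity, by linarith⟩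
    let G : E → F := fun y => χ y • w (Φ.symm y)
    have hsupp : tsupport χ ⊆ Φ.target := by
      rw [χ.tsupport_eq]
      exact (closedBall_subset_ball (by simp [χ]; linarith)).trans hball
    have hG : ContDiff ℝ ∞ G := by
      rw [contDiff_iff_contDiffAt]
      intro y
      by_cases hy : y ∈ tsupport χ
      · exact χ.contDiff.contDiffAt.smul (hw.contDiffAt.comp y
          (hΦs.contDiffAt (Φ.open_target.mem_nhds (hsupp hy))))
      · have : G =ᶠ[𝓝 y] fun _ => 0 := by
          filter_upwards [notMem_tsupport_iff_eventuallyEq.1 hy] with z hz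
          simp [G, hz]
        exact contDiffAt_const.congr_of_eventuallyEq this
    obtain ⟨K, hK, hGK⟩ := exists_eq_smul_of_eq_zero_on_ker hG hℓe fun y hy => by
      by_cases hy' : y ∈ tsupport χ
      · have : w (Φ.symm y) = 0 := hw₀ _ (by rw [← hℓ, Φ.right_inv (hsupp hy'), hy])
        simp [G, this]
      · simp [G, image_eq_zero_of_notMem_tsupport hy']
    refine ⟨Φ.source ∩ Φ ⁻¹' ball (Φ p) (ε / 3), ?_, K ∘ Φ, (hK.comp hΦ).contDiffOn, ?_⟩
    · exact inter_mem (Φ.open_source.mem_nhds hpΦ)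
        (hΦ.continuous.continuousAt (ball_mem_nhds _ (by positivity)))
    · rintro y ⟨hy, hy'⟩
      have h1 : χ (Φ y) = 1 := χ.one_of_mem_closedBall (ball_subset_closedBall hy')
      have h2 := hGK (Φ y)
      simpa [G, h1, Φ.left_inv hy, hℓ] using h2
  · have hopen : IsOpen {x | ρ x ≠ 0} := isOpen_ne_fun hρ.continuous continuous_const
    refine ⟨{x | ρ x ≠ 0}, hopen.mem_nhds hp, fun x => (ρ x)⁻¹ • w x, ?_, fun y hy => ?_⟩
    · exact (hρ.contDiffOn.inv fun x hx => hx).smul hw.contDiffOn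
    · simp [smul_smul, mul_inv_cancel₀ hy]

end HadamardDivision

section LevelSetTopology
open Set Filter Topology Metric
open scoped ContDiff
variable {E : Type*} [NormedAddCommGroup E] [NormedSpace ℝ E]

theorem eventually_neg_of_fderiv_neg {ρ : E → ℝ} {p v : E} (hρ : DifferentiableAt ℝ ρ p)
    (hp : ρ p = 0) (hv : fderiv ℝ ρ p v < 0) : ∀ᶠ t : ℝ in 𝓝[>] 0, ρ (p + t • v) < 0 := by
  have h1 : HasDerivAt (fun t : ℝ => p + t • v) v 0 := by
    simpa using ((hasDerivAt_id (0 : ℝ)).smul_const v).const_add p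
  have h0 : p = p + (0 : ℝ) • v := by simp
  have h2 : HasDerivAt (fun t : ℝ => ρ (p + t • v)) (fderiv ℝ ρ p v) 0 :=
    HasFDerivAt.comp_hasDerivAt (0 : ℝ) (by rw [← h0]; exact hρ.hasFDerivAt) h1
  have h3 := (hasDerivAt_iff_tendsto_slope.1 h2).eventually_lt_const hv
  have h4 : ∀ᶠ t : ℝ in 𝓝[>] 0, slope (fun t : ℝ => ρ (p + t • v)) 0 t < 0 :=
    h3.filter_mono (nhdsGT_le_nhdsNE 0)
  filter_upwards [h4, self_mem_nhdsWithin] with t ht ht0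
  rw [slope_def_field] at ht
  simp only [zero_smul, add_zero, hp, sub_zero] at ht
  exact (div_neg_iff.1 ht).elim (fun h => absurd h.2 (not_lt.2 (le_of_lt ht0))) fun h => h.1

theorem mem_tangentConeAt_of_fderiv_neg {ρ : E → ℝ} {p v : E} (hρ : DifferentiableAt ℝ ρ p)
    (hp : ρ p = 0) (hv : fderiv ℝ ρ p v < 0) : v ∈ tangentConeAt ℝ {x | ρ x < 0} p :=
  mem_tangentConeAt_of_add_smul_mem (tendsto_id'.mpr <| nhdsGT_le_nhdsNE 0)
    (eventually_neg_of_fderiv_neg hρ hp hv)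

theorem exists_fderiv_neg {ρ : E → ℝ} {p : E} (hp : fderiv ℝ ρ p ≠ 0) :
    ∃ v, fderiv ℝ ρ p v < 0 := by
  by_contra! h
  refine hp (ContinuousLinearMap.ext fun v => le_antisymm ?_ (h v))
  simpa using h (-v)

theorem mem_closure_neg {ρ : E → ℝ} {p : E} (hp₀ : ρ p = 0) (hp : fderiv ℝ ρ p ≠ 0) :
    p ∈ closure {x | ρ x < 0} := by
  obtain ⟨v, hv⟩ := exists_fderiv_neg hp
  have hd : DifferentiableAt ℝ ρ p := by
    by_contra h
    exact hp (fderiv_zero_of_not_differentiableAt h)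
  exact mem_closure_of_nonempty_tangentConeAt ⟨v, mem_tangentConeAt_of_fderiv_neg hd hp₀ hv⟩

theorem mem_closure_pos {ρ : E → ℝ} {p : E} (hp₀ : ρ p = 0) (hp : fderiv ℝ ρ p ≠ 0) :
    p ∈ closure {x | 0 < ρ x} := by
  have h := mem_closure_neg (ρ := fun x => -ρ x) (p := p) (by simp [hp₀])
    (by simpa [fderiv_fun_neg] using hp)
  simpa using h

theorem closure_neg_eq {ρ : E → ℝ} (hρ : Continuous ρ)
    (hreg : ∀ x, ρ x = 0 → fderiv ℝ ρ x ≠ 0) : closure {x | ρ x < 0} = {x | ρ x ≤ 0} := by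
  refine subset_antisymm (closure_minimal (fun x hx => le_of_lt (show ρ x < 0 from hx))
    (isClosed_le hρ continuous_const)) fun x hx => ?_
  rcases lt_or_eq_of_le (show ρ x ≤ 0 from hx) with h | h
  · exact subset_closure h
  · exact mem_closure_neg h (hreg x h)

theorem uniqueDiffOn_closure_neg {ρ : E → ℝ} (hρ : Differentiable ℝ ρ)
    (hreg : ∀ x, ρ x = 0 → fderiv ℝ ρ x ≠ 0) : UniqueDiffOn ℝ (closure {x | ρ x < 0}) := by
  have hopen : IsOpen {x | ρ x < 0} := isOpen_lt hρ.continuous continuous_const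
  intro p hp
  rw [closure_neg_eq hρ.continuous hreg] at hp
  rcases lt_or_eq_of_le (show ρ p ≤ 0 from hp) with h | h
  · exact (hopen.uniqueDiffWithinAt h).mono subset_closure
  · obtain ⟨e, he⟩ := exists_fderiv_neg (hreg p h)
    have hspan : Submodule.span ℝ (tangentConeAt ℝ {x | ρ x < 0} p) = ⊤ := by
      rw [Submodule.eq_top_iff']
      intro v
      have hmem : ∀ v, fderiv ℝ ρ p v < 0 →
          v ∈ Submodule.span ℝ (tangentConeAt ℝ {x | ρ x < 0} p) := fun v hv =>
        Submodule.subset_span (mem_tangentConeAt_of_fderiv_neg (hρ p) h hv)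
      rcases lt_trichotomy (fderiv ℝ ρ p v) 0 with hv | hv | hv
      · exact hmem v hv
      · have := Submodule.sub_mem _ (hmem (v + e) (by simpa [hv] using he)) (hmem e he)
        simpa using this
      · simpa using Submodule.neg_mem _ (hmem (-v) (by simpa using hv))
    exact (UniqueDiffWithinAt.mk (by rw [hspan]; exact dense_univ)
      (mem_closure_neg h (hreg p h))).mono subset_closure

variable [FiniteDimensional ℝ E]

theorem exists_preconnected_pos {ρ : E → ℝ} (hρ : ContDiff ℝ ∞ ρ) {p : E}
    (hp : fderiv ℝ ρ p ≠ 0) :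
    ∃ T, IsPreconnected T ∧ T ⊆ {x | 0 < ρ x} ∧ ∀ᶠ x in 𝓝 p, 0 < ρ x → x ∈ T := by
  obtain ⟨e, ℓ, Φ, hℓe, hpΦ, hΦ, hΦs, hℓ⟩ := exists_straightening hρ hp
  obtain ⟨ε, hε, hball⟩ := Metric.isOpen_iff.1 Φ.open_target _ (Φ.map_source hpΦ)
  have hconv : Convex ℝ (ball (Φ p) ε ∩ {y | 0 < ℓ y}) :=
    (convex_ball _ _).inter (convex_halfSpace_gt ℓ.toLinearMap.isLinear 0)
  refine ⟨Φ.symm '' (ball (Φ p) ε ∩ {y | 0 < ℓ y}), hconv.isPreconnected.image _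
    (hΦs.continuousOn.mono fun y hy => hball hy.1), ?_, ?_⟩
  · rintro _ ⟨y, ⟨hy, hy'⟩, rfl⟩
    simpa [← hℓ, Φ.right_inv (hball hy)] using hy'
  · filter_upwards [Φ.open_source.mem_nhds hpΦ,
      hΦ.continuous.continuousAt (ball_mem_nhds (Φ p) hε)] with x hx hx' h
    exact ⟨Φ x, ⟨hx', by simpa [hℓ] using h⟩, Φ.left_inv hx⟩

/-- The exterior of a connected regular level set is connected. -/
theorem isPreconnected_pos {ρ : E → ℝ} (hρ : ContDiff ℝ ∞ ρ)
    (hreg : ∀ x, ρ x = 0 → fderiv ℝ ρ x ≠ 0) (hconn : IsConnected {x | ρ x = 0}) :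
    IsPreconnected {x | 0 < ρ x} := by
  have hs : IsOpen {x | 0 < ρ x} := isOpen_lt continuous_const hρ.continuous
  suffices H : ∀ u v : Set E, IsOpen u → IsOpen v → Disjoint u v → u ∪ v = {x | 0 < ρ x} →
      u.Nonempty → v.Nonempty → False by
    intro u v hu hv huv hsu hsv
    by_contra hne
    refine H ({x | 0 < ρ x} ∩ u) ({x | 0 < ρ x} ∩ v) (hs.inter hu) (hs.inter hv) ?_ ?_ hsu hsv
    · rw [Set.disjoint_left]
      exact fun x hx hx' => hne ⟨x, hx.1, hx.2, hx'.2⟩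
    · rw [← inter_union_distrib_left, inter_eq_left]
      exact huv
  intro u v hu hv hd huv hun hvn
  have key : ∀ u v : Set E, IsOpen u → IsOpen v → Disjoint u v → u ∪ v = {x | 0 < ρ x} →
      u.Nonempty → ({x | ρ x = 0} ∩ {p | ∀ᶠ x in 𝓝 p, 0 < ρ x → x ∈ u}).Nonempty := by
    intro u v hu hv hd huv hun
    have hnc : ¬ IsClosed u := fun hc => by
      rcases isClopen_iff.1 ⟨hc, hu⟩ with h | h
      · exact hun.ne_empty h
      · obtain ⟨q, hq⟩ := hconn.nonempty
        have hq' : q ∈ u ∪ v := Or.inl (h ▸ mem_univ q)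
        rw [huv] at hq'
        exact (ne_of_gt hq') hq
    obtain ⟨p, hpc, hpu⟩ : ∃ p ∈ closure u, p ∉ u := by
      by_contra! h
      exact hnc (isClosed_of_closure_subset h)
    have hpv : p ∉ v := fun h => by
      obtain ⟨x, hx, hx'⟩ := mem_closure_iff.1 hpc v hv h
      exact Set.disjoint_left.1 hd hx' hx
    have hp0 : ρ p = 0 := by
      refine le_antisymm (not_lt.1 fun h => ?_) ?_
      · have : p ∈ u ∪ v := by rw [huv]; exact h
        exact this.elim hpu hpv
      · refine closure_minimal (s := u) (t := {x | 0 ≤ ρ x}) (fun x hx => ?_)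
          (isClosed_le continuous_const hρ.continuous) hpc
        have : x ∈ u ∪ v := Or.inl hx
        rw [huv] at this
        exact le_of_lt (show 0 < ρ x from this)
    obtain ⟨T, hT, hTs, hTp⟩ := exists_preconnected_pos hρ (hreg p hp0)
    refine ⟨p, hp0, ?_⟩
    rcases IsPreconnected.subset_or_subset hu hv hd (huv ▸ hTs) hT with h | h
    · exact hTp.mono fun x hx h0 => h (hx h0)
    · exfalso
      obtain ⟨x, hxT, hxu⟩ := mem_closure_iff_nhds.1 hpc _ hTp
      have : x ∈ u ∪ v := Or.inl hxu
      rw [huv] at this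
      exact Set.disjoint_left.1 hd hxu (h (hxT this))
  have hcover : {x | ρ x = 0} ⊆ {p | ∀ᶠ x in 𝓝 p, 0 < ρ x → x ∈ u} ∪
      {p | ∀ᶠ x in 𝓝 p, 0 < ρ x → x ∈ v} := by
    intro p hp
    obtain ⟨T, hT, hTs, hTp⟩ := exists_preconnected_pos hρ (hreg p hp)
    rcases IsPreconnected.subset_or_subset hu hv hd (huv ▸ hTs) hT with h | h
    · exact Or.inl (hTp.mono fun x hx h0 => h (hx h0))
    · exact Or.inr (hTp.mono fun x hx h0 => h (hx h0))
  obtain ⟨p, hp, hpu, hpv⟩ := hconn.isPreconnected _ _ isOpen_setOfPred_eventually_nhds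
    isOpen_setOfPred_eventually_nhds hcover (key u v hu hv hd huv hun)
    (key v u hv hu hd.symm (by rw [union_comm, huv]) hvn)
  obtain ⟨x, hx, hx'⟩ := mem_closure_iff_nhds.1 (mem_closure_pos hp (hreg p hp)) _
    (inter_mem hpu hpv)
  exact Set.disjoint_left.1 hd (hx.1 hx') (hx.2 hx')

theorem locallyPathConnectedSpace_levelSet {ρ : E → ℝ} (hρ : ContDiff ℝ ∞ ρ)
    (hreg : ∀ x, ρ x = 0 → fderiv ℝ ρ x ≠ 0) :
    LocallyPathConnectedSpace {x | ρ x = 0} := by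
  refine ⟨fun p => ⟨fun t => ⟨fun ht => ?_, fun ⟨i, hi, hit⟩ => mem_of_superset hi.1 hit⟩⟩⟩
  obtain ⟨ε, hε, r, hr, hr₀, hrid, -⟩ := exists_smooth_retraction hρ p.2 (hreg p p.2)
  obtain ⟨W, hW, hWt⟩ := mem_nhds_subtype _ _ _ |>.1 ht
  have hrp : r p = p := hrid p (mem_ball_self hε) p.2
  have hrc : ContinuousAt r p := hr.continuousOn.continuousAt (ball_mem_nhds _ hε)
  have hpre : r ⁻¹' W ∈ 𝓝 (p : E) := hrc (by rwa [hrp])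
  obtain ⟨δ, hδ, hδW⟩ := Metric.mem_nhds_iff.1 (inter_mem hpre (ball_mem_nhds (p : E) hε))
  have hpc : IsPathConnected (r '' ball (p : E) δ) :=
    ((convex_ball _ _).isPathConnected ⟨_, mem_ball_self hδ⟩).image'
      (hr.continuousOn.mono fun x hx => (hδW hx).2)
  have hsub : r '' ball (p : E) δ ⊆ {x | ρ x = 0} := by
    rintro _ ⟨x, hx, rfl⟩
    exact hr₀ x (hδW hx).2
  refine ⟨(↑) ⁻¹' (r '' ball (p : E) δ), ⟨?_, ?_⟩, ?_⟩
  · refine mem_of_superset (continuous_subtype_val.continuousAt (ball_mem_nhds (p : E) hδ)) ?_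
    intro x hx
    exact ⟨x, hx, hrid x (hδW hx).2 x.2⟩
  · exact IsInducing.subtypeVal.isPathConnected_iff.2 (by
      rwa [Subtype.image_preimage_coe, inter_eq_right.2 hsub])
  · rintro x ⟨y, hy, hyx⟩
    exact hWt (by
      rw [mem_preimage, ← hyx]
      exact (hδW hy).1)

end LevelSetTopology

section LocalSystem
open Set Filter Topology

/-- On a simply connected space, local functions that differ by locally constant functions
on overlaps glue, up to local constants, to a global function. -/
theorem exists_sub_locallyConstant {X A : Type*} [TopologicalSpace X] [SimplyConnectedSpace X]
    [LocallyPathConnectedSpace X] [AddCommGroup A] (U : X → Set X) (hU : ∀ i, IsOpen (U i))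
    (hmem : ∀ x, x ∈ U x) (φ : X → X → A)
    (hφ : ∀ i j, ∀ x ∈ U i ∩ U j, ∀ᶠ y in 𝓝 x, φ i y - φ j y = φ i x - φ j x) :
    ∃ F : X → A, ∀ i, ∀ x ∈ U i, ∀ᶠ y in 𝓝 x, F y - φ i y = F x - φ i x := by
  let _ : TopologicalSpace A := ⊥
  have : DiscreteTopology A := ⟨rfl⟩
  let Z : FiberBundleCore X X A :=
    { baseSet := U
      isOpen_baseSet := hU
      indexAt := id
      mem_baseSet_at := hmem
      coordChange := fun i j x v => v + (φ i x - φ j x)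
      coordChange_self := by intros; simp
      continuousOn_coordChange := by
        rintro i j ⟨x, v⟩ ⟨hx, -⟩
        refine ContinuousAt.continuousWithinAt (tendsto_nhds_of_eventually_eq ?_)
        rw [nhds_prod_eq, nhds_discrete A]
        filter_upwards [(hφ i j x hx).prod_mk (eventually_pure.2 (Eq.refl v))] with q hq
        simp [hq.1, hq.2]
      coordChange_comp := by intros; abel }
  have hcov : IsCoveringMap Z.proj :=
    IsFiberBundle.isCoveringMap fun x => ⟨Z.localTriv x, hmem x⟩
  obtain ⟨a₀⟩ : Nonempty X := inferInstance
  obtain ⟨s, ⟨-, hs⟩, -⟩ := hcov.existsUnique_continuousMap_lifts (ContinuousMap.id X) a₀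
    (⟨a₀, (0 : A)⟩ : Z.TotalSpace) rfl
  have hs' : ∀ y, (s y).1 = y := fun y => congrFun hs y
  refine ⟨fun x => (show A from (s x).2) + φ x x, fun i x hx => ?_⟩
  have h1 : ∀ y, (Z.localTriv i (s y)).2 = (show A from (s y).2) + φ y y - φ i y := by
    intro y
    rw [Z.localTriv_apply]
    change (show A from (s y).2) + (φ (s y).1 (s y).1 - φ i (s y).1) = _
    rw [hs' y]
    abel
  have h2 : ContinuousAt (fun y => (Z.localTriv i (s y)).2) x := by
    refine continuousAt_snd.comp (ContinuousAt.comp (f := s) ?_ s.continuous.continuousAt)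
    refine (Z.localTriv i).continuousOn.continuousAt ((Z.localTriv i).open_source.mem_nhds ?_)
    rw [Z.mem_localTriv_source]
    change (s x).1 ∈ U i
    rwa [hs' x]
  have h3 := h2.tendsto
  rw [nhds_discrete A, tendsto_pure] at h3
  filter_upwards [h3] with y hy
  rw [h1, h1] at hy
  exact hy

end LocalSystem

section CauchyPompeiu
open Set Filter Topology Metric MeasureTheory
open scoped ContDiff

/-- The **Cauchy–Pompeiu formula** at the origin for compactly supported functions. -/
theorem integral_inv_mul_dbar {φ : ℂ → ℂ} (hφ : ContDiff ℝ 1 φ) (hc : HasCompactSupport φ) :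
    ∫ z, z⁻¹ * ((fderiv ℝ φ z 1 + I * fderiv ℝ φ z I) / 2) = -(Real.pi * φ 0) := by
  obtain ⟨R, hR⟩ := hc.isBounded.exists_norm_le
  let e : ℝ → ℂ := fun θ => exp (θ * I)
  have he : ∀ θ, HasDerivAt e (I * e θ) θ := by
    intro θ
    have h1 : HasDerivAt (fun t : ℝ => (t : ℂ) * I) I θ := by
      simpa using (Complex.ofRealCLM.hasDerivAt (x := θ)).mul_const I
    simpa [e, mul_comm] using! h1.cexp
  have hec : Continuous e := by fun_prop
  have hen : ∀ θ, ‖e θ‖ = 1 := fun θ => Complex.norm_exp_ofReal_mul_I θ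
  have hD : Continuous (fderiv ℝ φ) := hφ.continuous_fderiv (by simp)
  let A : ℝ × ℝ → ℂ := fun p => fderiv ℝ φ (p.1 * e p.2) (e p.2)
  let B : ℝ × ℝ → ℂ := fun p => fderiv ℝ φ (p.1 * e p.2) (I * e p.2)
  have hAc : Continuous A := by fun_prop
  have hBc : Continuous B := by fun_prop
  have hbig : ∀ r θ : ℝ, R < r → fderiv ℝ φ (r * e θ) = 0 := by
    intro r θ hr
    by_contra h
    have h1 := hR _ (support_fderiv_subset ℝ h)
    rw [norm_mul, hen, mul_one, Complex.norm_real] at h1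
    exact absurd (h1.trans' (le_abs_self r)) (not_le.2 hr)
  have hint : ∀ f : ℝ × ℝ → ℂ, Continuous f → (∀ r θ : ℝ, R < r → f (r, θ) = 0) →
      IntegrableOn f (Ioi 0 ×ˢ Ioo (-Real.pi) Real.pi) (volume.prod volume) := by
    intro f hf hf0
    have h1 : IntegrableOn f (Icc 0 R ×ˢ Icc (-Real.pi) Real.pi) (volume.prod volume) :=
      hf.continuousOn.integrableOn_compact (isCompact_Icc.prod isCompact_Icc)
    have h2 : IntegrableOn f (Ici 0 ×ˢ Icc (-Real.pi) Real.pi) (volume.prod volume) := by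
      refine h1.of_forall_sdiff_eq_zero (measurableSet_Ici.prod measurableSet_Icc) ?_
      rintro ⟨r, θ⟩ ⟨h, h'⟩
      refine hf0 r θ ?_
      by_contra hr
      exact h' ⟨⟨h.1, not_lt.1 hr⟩, h.2⟩
    exact h2.mono_set (prod_mono Ioi_subset_Ici_self Ioo_subset_Icc_self)
  have hA := hint A hAc fun r θ hr => by simp [A, hbig r θ hr]
  have hB := hint B hBc fun r θ hr => by simp [B, hbig r θ hr]
  have hIA : ∫ p in Ioi 0 ×ˢ Ioo (-Real.pi) Real.pi, A p ∂(volume.prod volume)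
      = -(2 * Real.pi * φ 0) := by
    rw [← Measure.prod_restrict, integral_prod_symm]
    · have h1 : ∀ θ : ℝ, ∫ r in Ioi (0 : ℝ), A (r, θ) = -φ 0 := by
        intro θ
        have h2 : ∀ r ∈ Ici (0 : ℝ), HasDerivAt (fun r : ℝ => φ (r * e θ)) (A (r, θ)) r := by
          intro r _
          have h3 : HasDerivAt (fun r : ℝ => (r : ℂ) * e θ) (e θ) r := by
            simpa using (Complex.ofRealCLM.hasDerivAt (x := r)).mul_const (e θ)
          exact ((hφ.differentiable (by simp) _).hasFDerivAt).comp_hasDerivAt r h3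
        have h4 : IntegrableOn (fun r => A (r, θ)) (Ioi 0) := by
          have h5 : IntegrableOn (fun r => A (r, θ)) (Icc 0 R) :=
            (hAc.comp (by fun_prop : Continuous fun r : ℝ => (r, θ))).continuousOn.integrableOn_Icc
          refine (h5.of_forall_sdiff_eq_zero (t := Ici 0) measurableSet_Ici ?_).mono_set
            Ioi_subset_Ici_self
          rintro r ⟨h, h'⟩
          have : R < r := by
            by_contra hr
            exact h' ⟨h, not_lt.1 hr⟩
          simp [A, hbig r θ this]
        have h6 : Tendsto (fun r : ℝ => φ (r * e θ)) atTop (𝓝 0) := by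
          refine tendsto_const_nhds.congr' ?_
          filter_upwards [eventually_gt_atTop R] with r hr
          by_contra h
          have h1 := hR _ (subset_tsupport _ (Ne.symm h))
          rw [norm_mul, hen, mul_one, Complex.norm_real] at h1
          exact absurd (h1.trans' (le_abs_self r)) (not_le.2 hr)
        rw [integral_Ioi_of_hasDerivAt_of_tendsto' h2 h4 h6]
        simp
      simp_rw [h1]
      rw [setIntegral_const, Measure.real, Real.volume_Ioo, ENNReal.toReal_ofReal
        (by linarith [Real.pi_pos])]
      rw [Complex.real_smul]
      push_cast
      ring
    · rw [Measure.prod_restrict]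
      exact hA
  have hIB : ∫ p in Ioi 0 ×ˢ Ioo (-Real.pi) Real.pi, B p ∂(volume.prod volume) = 0 := by
    rw [setIntegral_prod _ hB]
    refine setIntegral_eq_zero_of_forall_eq_zero fun r hr => ?_
    have hr0 : (r : ℂ) ≠ 0 := by exact_mod_cast (ne_of_gt hr)
    have h2 : ∀ θ : ℝ, HasDerivAt (fun θ : ℝ => (r : ℂ)⁻¹ * φ (r * e θ)) (B (r, θ)) θ := by
      intro θ
      have h3 := ((hφ.differentiable (by simp) (r * e θ)).hasFDerivAt).comp_hasDerivAt θ
        ((he θ).const_mul (r : ℂ))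
      have h4 := h3.const_mul (r : ℂ)⁻¹
      have h5 : fderiv ℝ φ (r * e θ) (r * (I * e θ)) = r * B (r, θ) := by
        rw [← Complex.real_smul (x := r) (z := I * e θ), map_smul, Complex.real_smul]
      rw [h5, inv_mul_cancel_left₀ hr0] at h4
      exact h4
    have h6 := intervalIntegral.integral_eq_sub_of_hasDerivAt (a := -Real.pi) (b := Real.pi)
      (fun θ _ => h2 θ)
      ((hBc.comp (by fun_prop : Continuous fun θ : ℝ => (r, θ))).intervalIntegrable _ _)
    rw [intervalIntegral.integral_of_le (by linarith [Real.pi_pos]),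
      integral_Ioc_eq_integral_Ioo] at h6
    change ∫ θ in Ioo (-Real.pi) Real.pi, B (r, θ) = 0
    rw [h6]
    have : e Real.pi = e (-Real.pi) := by
      simp [e, Complex.exp_neg]
    rw [this, sub_self]
  rw [← Complex.integral_comp_polarCoord_symm]
  have h7 : ∀ p ∈ polarCoord.target, (p.1 • ((Complex.polarCoord.symm p)⁻¹ *
      ((fderiv ℝ φ (Complex.polarCoord.symm p) 1 +
        I * fderiv ℝ φ (Complex.polarCoord.symm p) I) / 2)) : ℂ) = (A p + I * B p) / 2 := by
    rintro ⟨r, θ⟩ hp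
    have hr : (0 : ℝ) < r := hp.1
    have hr0 : (r : ℂ) ≠ 0 := by exact_mod_cast hr.ne'
    have h8 : Complex.polarCoord.symm (r, θ) = r * e θ := by
      rw [Complex.polarCoord_symm_apply]
      simp [e, Complex.exp_mul_I]
    rw [h8]
    have h9 : e θ = Real.cos θ • (1 : ℂ) + Real.sin θ • I := by
      simp [e, Complex.exp_mul_I]
    have h10 : I * e θ = Real.cos θ • I - Real.sin θ • (1 : ℂ) := by
      rw [h9]
      simp only [Complex.real_smul]
      linear_combination (Real.sin θ : ℂ) * I_sq
    have h11 : (e θ)⁻¹ = Real.cos θ - Real.sin θ * I := by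
      rw [← Complex.exp_neg, ← neg_mul, ← Complex.ofReal_neg, Complex.exp_mul_I]
      simp [sub_eq_add_neg]
    simp only [A, B]
    rw [h10]
    conv_rhs => rw [show fderiv ℝ φ (r * e θ) (e θ) = fderiv ℝ φ (r * e θ)
      (Real.cos θ • (1 : ℂ) + Real.sin θ • I) by rw [← h9]]
    simp only [map_add, map_sub, map_smul]
    simp only [Complex.real_smul]
    rw [mul_inv, mul_assoc, mul_inv_cancel_left₀ hr0, h11]
    linear_combination -(fderiv ℝ φ (r * e θ) I * Real.sin θ / 2) * I_sq
  rw [setIntegral_congr_fun polarCoord.open_target.measurableSet h7]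
  change ∫ p in Ioi 0 ×ˢ Ioo (-Real.pi) Real.pi, (A p + I * B p) / 2 ∂(volume.prod volume) = _
  rw [integral_div, integral_add hA (hB.const_mul I), integral_const_mul, hIA, hIB]
  ring

end CauchyPompeiu

section CauchyTransform
open Set Filter Topology Metric MeasureTheory
open scoped ContDiff Convolution

theorem integrableOn_closedBall_inv (K : ℝ) :
    IntegrableOn (fun τ : ℂ => τ⁻¹) (closedBall 0 K) := by
  have h1 : Integrable (fun τ : ℂ => (Iic K).indicator (fun y : ℝ => y⁻¹) ‖τ‖) := by
    rw [integrable_fun_norm_addHaar]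
    have h2 : IntegrableOn (fun _ : ℝ => (1 : ℝ)) (Ioc 0 K) := by simp
    have h3 : IntegrableOn ((Iic K).indicator fun _ : ℝ => (1 : ℝ)) (Ioi 0) := by
      rw [← Ioi_inter_Iic, inter_comm] at h2
      rw [IntegrableOn, integrable_indicator_iff measurableSet_Iic, IntegrableOn,
        Measure.restrict_restrict measurableSet_Iic]
      exact h2
    refine h3.congr_fun (fun y hy => ?_) measurableSet_Ioi
    have hy0 : y ≠ 0 := ne_of_gt hy
    by_cases hK : y ≤ K <;> simp [indicator, hK, Complex.finrank_real_complex, hy0]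
  refine (h1.integrableOn (s := closedBall (0 : ℂ) K)).mono' ?_ ?_
  · exact measurable_inv.aestronglyMeasurable
  · refine (ae_restrict_mem measurableSet_closedBall).mono fun τ hτ => ?_
    have : ‖τ‖ ≤ K := by simpa using hτ
    simp [indicator, this]

theorem locallyIntegrable_inv : LocallyIntegrable (fun τ : ℂ => τ⁻¹) volume := fun z =>
  ⟨closedBall 0 (‖z‖ + 1), closedBall_mem_nhds_of_mem (by simp), integrableOn_closedBall_inv _⟩

variable {E : Type*} [NormedAddCommGroup E] [NormedSpace ℝ E]

theorem contDiff_cauchyTransform {m : ℕ∞} {g : E → ℂ} (hg : ContDiff ℝ m g)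
    (hc : HasCompactSupport g) (L : ℂ →ₗᵢ[ℝ] E) :
    ContDiff ℝ m fun p => ∫ τ : ℂ, τ⁻¹ * g (p - L τ) := by
  obtain ⟨R, hR⟩ := hc.isBounded.exists_norm_le
  rw [contDiff_iff_contDiffAt]
  intro p
  have hK := contDiffOn_convolution_right_with_param_comp (n := m) (μ := volume)
    (ContinuousLinearMap.mul ℝ ℂ) (s := ball p 1) (v := fun _ : E => (0 : ℂ)) contDiffOn_const
    (f := fun τ : ℂ => τ⁻¹) (g := fun q τ => g (q + L τ))
    (k := closedBall 0 (R + ‖p‖ + 1)) isOpen_ball (isCompact_closedBall _ _) (fun q x hq hx => by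
      by_contra h
      have h1 := hR _ (subset_tsupport _ h)
      have h2 : ‖x‖ ≤ ‖q + L x‖ + ‖q‖ := by
        rw [← L.norm_map]
        calc ‖L x‖ = ‖q + L x - q‖ := by rw [add_sub_cancel_left]
          _ ≤ _ := norm_sub_le _ _
      have h3 : ‖q‖ ≤ ‖p‖ + 1 := by
        have := norm_le_norm_add_norm_sub' q p
        rw [mem_ball, dist_eq_norm] at hq
        linarith
      exact hx (by rw [mem_closedBall_zero_iff]; linarith)) locallyIntegrable_inv
    (hg.comp (contDiff_fst.add
      (L.toContinuousLinearMap.contDiff.comp contDiff_snd))).contDiffOn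
  have h := hK.contDiffAt (ball_mem_nhds p one_pos)
  convert h using 1
  ext q
  rw [convolution_def]
  simp [sub_eq_add_neg]

theorem fderiv_cauchyTransform {g : E → ℂ} (hg : ContDiff ℝ 1 g)
    (hc : HasCompactSupport g) (L : ℂ →ₗᵢ[ℝ] E) (p v : E) :
    fderiv ℝ (fun p => ∫ τ : ℂ, τ⁻¹ * g (p - L τ)) p v
      = ∫ τ : ℂ, τ⁻¹ * fderiv ℝ g (p - L τ) v := by
  obtain ⟨R, hR⟩ := hc.isBounded.exists_norm_le
  have hD : Continuous (fderiv ℝ g) := hg.continuous_fderiv (by simp)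
  obtain ⟨M, hM⟩ := (hc.fderiv (𝕜 := ℝ)).exists_bound_of_continuous hD
  have hT := contDiff_cauchyTransform (m := 1) (by exact_mod_cast hg) hc L
  have hline : HasDerivAt (fun t : ℝ => p + t • v) v 0 := by
    simpa using ((hasDerivAt_id (0 : ℝ)).smul_const v).const_add p
  have h1 : HasDerivAt (fun t : ℝ => ∫ τ : ℂ, τ⁻¹ * g (p + t • v - L τ))
      (fderiv ℝ (fun p => ∫ τ : ℂ, τ⁻¹ * g (p - L τ)) p v) 0 :=
    HasFDerivAt.comp_hasDerivAt (0 : ℝ) (l := fun p => ∫ τ : ℂ, τ⁻¹ * g (p - L τ))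
      (by simpa using (hT.differentiable (by simp) p).hasFDerivAt) hline
  have hsupp : ∀ t ∈ ball (0 : ℝ) 1, ∀ τ, τ ∉ closedBall (0 : ℂ) (R + ‖p‖ + ‖v‖) →
      p + t • v - L τ ∉ tsupport g := by
    intro t ht τ hτ h
    have h2 := hR _ h
    have h3 : ‖τ‖ ≤ ‖p + t • v‖ + ‖p + t • v - L τ‖ := by
      rw [← L.norm_map]
      calc ‖L τ‖ = ‖(p + t • v) - (p + t • v - L τ)‖ := by rw [sub_sub_cancel]
        _ ≤ _ := norm_sub_le _ _
    have h4 : ‖p + t • v‖ ≤ ‖p‖ + ‖v‖ := by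
      refine (norm_add_le _ _).trans ?_
      rw [norm_smul]
      have : ‖t‖ ≤ 1 := by simpa using (mem_ball_zero_iff.1 ht).le
      nlinarith [norm_nonneg v]
    exact hτ (by rw [mem_closedBall_zero_iff]; linarith)
  have hmeas : ∀ h : E → ℂ, Continuous h → ∀ t : ℝ,
      AEStronglyMeasurable (fun τ : ℂ => τ⁻¹ * h (p + t • v - L τ)) volume := by
    intro h hh t
    refine measurable_inv.aestronglyMeasurable.mul (Continuous.aestronglyMeasurable ?_)
    have := L.continuous
    fun_prop
  have hint : ∀ C : ℝ, Integrable
      ((closedBall (0 : ℂ) (R + ‖p‖ + ‖v‖)).indicator fun τ : ℂ => ‖τ⁻¹‖ * C) := by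
    intro C
    rw [integrable_indicator_iff measurableSet_closedBall]
    exact (integrableOn_closedBall_inv _).norm.mul_const C
  have h2 := hasDerivAt_integral_of_dominated_loc_of_deriv_le (μ := volume) (x₀ := (0 : ℝ))
    (F := fun t τ => τ⁻¹ * g (p + t • v - L τ))
    (F' := fun t τ => τ⁻¹ * fderiv ℝ g (p + t • v - L τ) v) (s := ball 0 1)
    (bound := (closedBall (0 : ℂ) (R + ‖p‖ + ‖v‖)).indicator fun τ : ℂ => ‖τ⁻¹‖ * (M * ‖v‖))
    (ball_mem_nhds _ one_pos) (.of_forall fun t => hmeas g hg.continuous t) ?_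
    (hmeas _ (hD.clm_apply continuous_const) 0) ?_ (hint _) ?_
  · rw [h1.unique h2.2]
    simp
  · obtain ⟨C, hC⟩ := hc.exists_bound_of_continuous hg.continuous
    refine (hint C).mono' (hmeas g hg.continuous 0) (.of_forall fun τ => ?_)
    by_cases hτ : τ ∈ closedBall (0 : ℂ) (R + ‖p‖ + ‖v‖)
    · rw [indicator_of_mem hτ, norm_mul]
      gcongr
      exact hC _
    · rw [image_eq_zero_of_notMem_tsupport (hsupp 0 (by simp) τ hτ), indicator_of_notMem hτ]
      simp
  · refine .of_forall fun τ t ht => ?_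
    by_cases hτ : τ ∈ closedBall (0 : ℂ) (R + ‖p‖ + ‖v‖)
    · rw [indicator_of_mem hτ, norm_mul]
      gcongr
      exact ((fderiv ℝ g _).le_opNorm v).trans (by gcongr; exact hM _)
    · rw [image_eq_zero_of_notMem_tsupport
        (fun h => hsupp t ht τ hτ (tsupport_fderiv_subset ℝ h)), indicator_of_notMem hτ]
      simp
  · refine .of_forall fun τ t _ => ?_
    have h3 : HasDerivAt (fun t : ℝ => p + t • v - L τ) v t := by
      simpa using (((hasDerivAt_id t).smul_const v).const_add p).sub_const (L τ)
    have h4 := ((hg.differentiable (by simp) (p + t • v - L τ)).hasFDerivAt).comp_hasDerivAt t h3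
    exact h4.const_mul τ⁻¹

end CauchyTransform

section DbarCompactSupport
open Set Filter Topology Metric MeasureTheory
open scoped ContDiff
variable {n : ℕ}

theorem contDiff_wirtBar {m k : ℕ∞ω} {f : (Fin n → ℂ) → ℂ} (hf : ContDiff ℝ m f)
    (hk : k + 1 ≤ m) (j : Fin n) : ContDiff ℝ k (wirtBar j f) := by
  have h := hf.fderiv_right hk
  exact ((h.clm_apply contDiff_const).add
    (contDiff_const.mul (h.clm_apply contDiff_const))).div_const 2

/-- Solution of the `∂̄`-equation with compactly supported data by the Cauchy transform in one
coordinate; in dimension at least two the solution vanishes near infinity in the direction of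
another coordinate. -/
theorem exists_wirtBar_eq {m : ℕ∞} (hm : 1 ≤ m) {g : Fin n → (Fin n → ℂ) → ℂ}
    (hg : ∀ k, ContDiff ℝ m (g k)) (hc : ∀ k, HasCompactSupport (g k))
    (hcompat : ∀ j k x, wirtBar j (g k) x = wirtBar k (g j) x) (i₀ : Fin n) :
    ∃ v : (Fin n → ℂ) → ℂ, ContDiff ℝ m v ∧ (∀ k x, wirtBar k v x = g k x) ∧
      ∃ R : ℝ, ∀ x k, k ≠ i₀ → R < ‖x k‖ → v x = 0 := by
  let L : ℂ →ₗᵢ[ℝ] (Fin n → ℂ) :=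
    ⟨LinearMap.single ℝ (fun _ : Fin n => ℂ) i₀, fun τ => by simp [Pi.norm_single]⟩
  have hL : ∀ τ, L τ = Pi.single i₀ τ := fun _ => rfl
  have hg1 : ∀ k, ContDiff ℝ 1 (g k) := fun k => (hg k).of_le (by exact_mod_cast hm)
  let T : (Fin n → ℂ) → ℂ := fun p => ∫ τ : ℂ, τ⁻¹ * g i₀ (p - L τ)
  have hT : ContDiff ℝ m T := contDiff_cauchyTransform (hg i₀) (hc i₀) L
  have hTd : Differentiable ℝ T := hT.differentiable (by
    have : (1 : ℕ∞ω) ≤ m := by exact_mod_cast hm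
    exact (zero_lt_one.trans_le this).ne')
  have hD : ∀ k, Continuous (fderiv ℝ (g k)) := fun k => (hg1 k).continuous_fderiv (by simp)
  have hint : ∀ p w, Integrable fun τ : ℂ => τ⁻¹ * fderiv ℝ (g i₀) (p - L τ) w := by
    intro p w
    obtain ⟨R, hR⟩ := (hc i₀).isBounded.exists_norm_le
    have h1 : HasCompactSupport fun τ => fderiv ℝ (g i₀) (p - L τ) w := by
      refine HasCompactSupport.intro (isCompact_closedBall 0 (R + ‖p‖)) fun τ hτ => ?_
      rw [image_eq_zero_of_notMem_tsupport (f := fderiv ℝ (g i₀)), zero_apply]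
      intro h
      have h2 := hR _ (tsupport_fderiv_subset ℝ h)
      refine hτ (mem_closedBall_zero_iff.2 ?_)
      have h3 : ‖τ‖ ≤ ‖p‖ + ‖p - L τ‖ := by
        rw [← L.norm_map]
        calc ‖L τ‖ = ‖p - (p - L τ)‖ := by rw [sub_sub_cancel]
          _ ≤ _ := norm_sub_le _ _
      linarith
    have h2 : Continuous fun τ => fderiv ℝ (g i₀) (p - L τ) w := by
      have := L.continuous
      have := hD i₀
      fun_prop
    have h3 := locallyIntegrable_inv.integrable_smul_right_of_hasCompactSupport h2 h1
    simpa [smul_eq_mul] using h3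
  refine ⟨fun p => (Real.pi : ℂ)⁻¹ * T p, contDiff_const.mul hT, fun k p => ?_, ?_⟩
  · have h1 : wirtBar k (fun p => (Real.pi : ℂ)⁻¹ * T p) p
        = (Real.pi : ℂ)⁻¹ * ∫ τ : ℂ, τ⁻¹ * wirtBar k (g i₀) (p - L τ) := by
      unfold wirtBar
      rw [fderiv_const_mul (hTd p)]
      simp only [smul_apply, smul_eq_mul]
      rw [fderiv_cauchyTransform (hg1 i₀) (hc i₀) L, fderiv_cauchyTransform (hg1 i₀) (hc i₀) L]
      rw [mul_left_comm, ← mul_add, mul_div_assoc]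
      congr 1
      rw [← integral_const_mul, ← integral_add (hint _ _) ((hint _ _).const_mul I), ← integral_div]
      congr 1
      ext τ
      ring
    rw [h1]
    let φ : ℂ → ℂ := fun τ => g k (p - L τ)
    have hφ : ContDiff ℝ 1 φ :=
      (hg1 k).comp (contDiff_const.sub L.toContinuousLinearMap.contDiff)
    have hφc : HasCompactSupport φ := by
      obtain ⟨R, hR⟩ := (hc k).isBounded.exists_norm_le
      refine HasCompactSupport.intro (isCompact_closedBall 0 (R + ‖p‖)) fun τ hτ => ?_
      by_contra h
      have h2 := hR _ (subset_tsupport _ h)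
      refine hτ (mem_closedBall_zero_iff.2 ?_)
      have h3 : ‖τ‖ ≤ ‖p‖ + ‖p - L τ‖ := by
        rw [← L.norm_map]
        calc ‖L τ‖ = ‖p - (p - L τ)‖ := by rw [sub_sub_cancel]
          _ ≤ _ := norm_sub_le _ _
      linarith
    have hφd : ∀ τ w, fderiv ℝ φ τ w = -fderiv ℝ (g k) (p - L τ) (Pi.single i₀ w) := by
      intro τ w
      have h2 : HasFDerivAt (fun τ => p - L τ) (-L.toContinuousLinearMap) τ :=
        (L.toContinuousLinearMap.hasFDerivAt).const_sub p
      have h3 : HasFDerivAt φ _ τ :=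
        (((hg1 k).differentiable (by simp) (p - L τ)).hasFDerivAt).comp τ h2
      rw [h3.fderiv]
      simp [hL]
    have h2 := integral_inv_mul_dbar hφ hφc
    have h3 : ∀ τ : ℂ, τ⁻¹ * wirtBar k (g i₀) (p - L τ)
        = -(τ⁻¹ * ((fderiv ℝ φ τ 1 + I * fderiv ℝ φ τ I) / 2)) := by
      intro τ
      rw [hcompat, hφd, hφd, wirtBar]
      ring
    simp_rw [h3]
    rw [integral_neg, h2, neg_neg, inv_mul_cancel_left₀ (by exact_mod_cast Real.pi_ne_zero)]
    simp [φ]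
  · obtain ⟨R, hR⟩ := (hc i₀).isBounded.exists_norm_le
    refine ⟨R, fun x k hk hx => ?_⟩
    have h1 : ∀ τ, g i₀ (x - L τ) = 0 := by
      intro τ
      by_contra h
      have h2 := hR _ (subset_tsupport _ h)
      have h3 := norm_le_pi_norm (x - L τ) k
      rw [Pi.sub_apply, show L τ k = 0 by rw [hL, Pi.single_eq_of_ne hk], sub_zero] at h3
      linarith
    simp [T, h1]

end DbarCompactSupport

section SeveralVariables
open Set Filter Topology Metric
open scoped ContDiff
variable {n : ℕ}

theorem fderiv_eq_sum_wirt (f : (Fin n → ℂ) → ℂ) (x v : Fin n → ℂ) :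
    fderiv ℝ f x v = ∑ j, (v j * wirt j f x + conj (v j) * wirtBar j f x) := by
  have h1 : v = ∑ j, ((v j).re • (Pi.single j 1 : Fin n → ℂ) +
      (v j).im • (Pi.single j I : Fin n → ℂ)) := by
    conv_lhs => rw [← Finset.univ_sum_single v]
    refine Finset.sum_congr rfl fun j _ => ?_
    rw [← Pi.single_smul, ← Pi.single_smul, ← Pi.single_add]
    congr 1
    simp only [Complex.real_smul, mul_one]
    exact (Complex.re_add_im _).symm
  conv_lhs => rw [h1]
  rw [map_sum]
  refine Finset.sum_congr rfl fun j _ => ?_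
  rw [map_add, map_smul, map_smul, wirt, wirtBar]
  conv_rhs => rw [← Complex.re_add_im (v j)]
  simp only [Complex.real_smul, map_add, map_mul, conj_ofReal, conj_I]
  linear_combination (v j).im * (fderiv ℝ f x (Pi.single j I)) * I_sq

theorem differentiableAt_of_wirtBar_eq_zero {f : (Fin n → ℂ) → ℂ} {x : Fin n → ℂ}
    (hf : DifferentiableAt ℝ f x) (h : ∀ j, wirtBar j f x = 0) : DifferentiableAt ℂ f x := by
  rw [differentiableAt_iff_restrictScalars ℝ hf]
  refine ⟨∑ j, (wirt j f x) • ContinuousLinearMap.proj (R := ℂ) j, ?_⟩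
  ext v
  simp [fderiv_eq_sum_wirt, h, mul_comm]

theorem eqOn_zero_of_preconnected_of_eventuallyEq_zero {E : Type*} [NormedAddCommGroup E]
    [NormedSpace ℂ E] {f : E → ℂ} {V : Set E} (hV : IsOpen V)
    (hVc : IsPreconnected V) (hf : DifferentiableOn ℂ f V) {x₀ : E} (hx₀ : x₀ ∈ V)
    (h₀ : f =ᶠ[𝓝 x₀] 0) : EqOn f 0 V := by
  have hA : IsOpen {x | f =ᶠ[𝓝 x] 0} := isOpen_setOfPred_eventually_nhds
  have key : V ⊆ {x | f =ᶠ[𝓝 x] 0} := by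
    refine hVc.subset_of_closure_inter_subset hA ⟨x₀, hx₀, h₀⟩ ?_
    rintro x ⟨hxA, hxV⟩
    obtain ⟨ε, hε, hball⟩ := Metric.isOpen_iff.1 hV x hxV
    obtain ⟨y, hyA, hyx⟩ := Metric.mem_closure_iff.1 hxA ε hε
    have hy : y ∈ ball x ε := by rwa [mem_ball, dist_comm]
    refine Filter.mem_of_superset (ball_mem_nhds x hε) fun z hz => ?_
    let l : ℂ → E := fun t => y + t • (z - y)
    have hl : Differentiable ℂ l := by fun_prop
    have hTo : IsOpen (l ⁻¹' ball x ε) := isOpen_ball.preimage hl.continuous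
    have hTc : IsPreconnected (l ⁻¹' ball x ε) := by
      refine Convex.isPreconnected ?_
      intro s hs t ht a b ha hb hab
      have h1 : l (a • s + b • t) = (a : ℂ) • l s + (b : ℂ) • l t := by
        obtain rfl : b = 1 - a := by linarith
        simp only [l, Complex.real_smul]
        push_cast
        module
      rw [mem_preimage, h1]
      let _ : NormedSpace ℝ E := NormedSpace.restrictScalars ℝ ℂ E
      exact convex_ball x ε hs ht ha hb hab
    have hh : DifferentiableOn ℂ (f ∘ l) (l ⁻¹' ball x ε) :=
      hf.comp hl.differentiableOn fun t ht => hball ht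
    have h0 : (0 : ℂ) ∈ l ⁻¹' ball x ε := by simpa [l] using hy
    have h0' : f ∘ l =ᶠ[𝓝 0] 0 := by
      have : Tendsto l (𝓝 0) (𝓝 y) := by
        simpa [l] using hl.continuous.tendsto 0
      exact this.eventually hyA
    have h1 := (hh.analyticOnNhd hTo).eqOn_zero_of_preconnected_of_eventuallyEq_zero hTc h0 h0'
    have h2 : (1 : ℂ) ∈ l ⁻¹' ball x ε := by simpa [l] using hz
    simpa [l] using h1 h2
  exact fun x hx => (key hx).self_of_nhds

end SeveralVariables

section DbarInside
open Set Filter Topology Metric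
open scoped ContDiff
variable {n : ℕ}

theorem exists_wirtBar_eq_of_eq_zero_outside (hn : 2 ≤ n) {ρ : (Fin n → ℂ) → ℝ}
    (hρ : ContDiff ℝ ∞ ρ) (hreg : ∀ x, ρ x = 0 → fderiv ℝ ρ x ≠ 0)
    (hbdd : Bornology.IsBounded {x | ρ x < 0}) (hconn : IsConnected {x | ρ x = 0})
    {m : ℕ∞} (hm : 1 ≤ m) {g : Fin n → (Fin n → ℂ) → ℂ} (hg : ∀ k, ContDiff ℝ m (g k))
    (hg₀ : ∀ k x, 0 ≤ ρ x → g k x = 0)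
    (hcompat : ∀ j k x, wirtBar j (g k) x = wirtBar k (g j) x) :
    ∃ v : (Fin n → ℂ) → ℂ, ContDiff ℝ m v ∧ (∀ k x, wirtBar k v x = g k x) ∧
      ∀ x, 0 ≤ ρ x → v x = 0 := by
  have hc : ∀ k, HasCompactSupport (g k) := fun k =>
    HasCompactSupport.intro hbdd.isCompact_closure fun x hx => hg₀ k x <| not_lt.1 fun h =>
      hx (subset_closure h)
  obtain ⟨v, hv, hvg, R, hR⟩ := exists_wirtBar_eq hm hg hc hcompat ⟨0, by omega⟩
  refine ⟨v, hv, hvg, ?_⟩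
  let k : Fin n := ⟨1, by omega⟩
  have hk : k ≠ ⟨0, by omega⟩ := by simp [k]
  have hm0 : (m : ℕ∞ω) ≠ 0 := by
    have : (1 : ℕ∞ω) ≤ m := by exact_mod_cast hm
    exact (zero_lt_one.trans_le this).ne'
  have hV : IsOpen {x | 0 < ρ x} := isOpen_lt continuous_const hρ.continuous
  have hcl := closure_neg_eq hρ.continuous hreg
  obtain ⟨R', hR'⟩ := hbdd.isCompact_closure.isBounded.exists_norm_le
  let x₀ : Fin n → ℂ := Pi.single k ((max (max R R') 0 + 1 : ℝ) : ℂ)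
  have hx₀ : ‖x₀ k‖ = max (max R R') 0 + 1 := by
    simp only [x₀, Pi.single_eq_same, Complex.norm_real]
    exact Real.norm_of_nonneg (by positivity)
  have hRx : R < ‖x₀ k‖ := by
    rw [hx₀]
    linarith [le_max_left R R', le_max_left (max R R') 0]
  have hx₀V : x₀ ∈ {x | 0 < ρ x} := by
    by_contra h
    have h1 := hR' x₀ (by rw [hcl]; exact not_lt.1 (show ¬0 < ρ x₀ from h))
    have h2 := norm_le_pi_norm x₀ k
    linarith [le_max_right R R', le_max_left (max R R') 0]
  have hpos : EqOn v 0 {x | 0 < ρ x} := by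
    refine eqOn_zero_of_preconnected_of_eventuallyEq_zero hV (isPreconnected_pos hρ hreg hconn)
      (fun x hx => DifferentiableAt.differentiableWithinAt ?_) hx₀V ?_
    · refine differentiableAt_of_wirtBar_eq_zero (hv.differentiable hm0 x) fun j => ?_
      rw [hvg]
      exact hg₀ j x (le_of_lt (show 0 < ρ x from hx))
    · have : ∀ᶠ x : Fin n → ℂ in 𝓝 x₀, R < ‖x k‖ :=
        (continuous_apply k).norm.continuousAt.eventually (lt_mem_nhds hRx)
      exact this.mono fun x hx => hR x k hk hx
  have hposc : EqOn v 0 (closure {x | 0 < ρ x}) :=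
    hpos.closure hv.continuous continuous_const
  intro x hx
  rcases hx.lt_or_eq with h | h
  · exact hpos h
  · exact hposc (mem_closure_pos h.symm (hreg x h.symm))

end DbarInside

section WirtingerCalculus
open Set Filter Topology Metric
open scoped ContDiff
variable {n : ℕ} {f g : (Fin n → ℂ) → ℂ} {x : Fin n → ℂ}

theorem Filter.EventuallyEq.wirtBar_eq (h : f =ᶠ[𝓝 x] g) (j : Fin n) :
    wirtBar j f x = wirtBar j g x := by
  rw [wirtBar, wirtBar, h.fderiv_eq]

theorem wirtBar_mul (hf : DifferentiableAt ℝ f x) (hg : DifferentiableAt ℝ g x) (j : Fin n) :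
    wirtBar j (fun y => f y * g y) x = f x * wirtBar j g x + g x * wirtBar j f x := by
  simp only [wirtBar]
  rw [fderiv_fun_mul hf hg]
  simp only [add_apply, smul_apply, smul_eq_mul]
  ring

theorem wirtBar_sub (hf : DifferentiableAt ℝ f x) (hg : DifferentiableAt ℝ g x) (j : Fin n) :
    wirtBar j (fun y => f y - g y) x = wirtBar j f x - wirtBar j g x := by
  simp only [wirtBar]
  rw [fderiv_fun_sub hf hg]
  simp only [sub_apply]
  ring

theorem wirtBar_pow (hf : DifferentiableAt ℝ f x) (k : ℕ) (j : Fin n) :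
    wirtBar j (fun y => f y ^ (k + 1)) x = (k + 1) * f x ^ k * wirtBar j f x := by
  simp only [wirtBar]
  rw [fderiv_fun_pow _ hf]
  simp only [smul_apply, smul_eq_mul, nsmul_eq_mul]
  simp
  ring

theorem wirtBar_conj (f : (Fin n → ℂ) → ℂ) (x : Fin n → ℂ) (j : Fin n) :
    wirtBar j (fun y => conj (f y)) x = conj (wirt j f x) := by
  have h : ∀ v, fderiv ℝ (fun y => conj (f y)) x v = conj (fderiv ℝ f x v) := by
    intro v
    have h1 : (fun y => conj (f y)) = (conjCLE : ℂ ≃L[ℝ] ℂ) ∘ f := rfl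
    rw [h1, ContinuousLinearEquiv.comp_fderiv]
    rfl
  simp only [wirtBar, wirt, h]
  rw [map_div₀, map_sub, map_mul, conj_I, Complex.conj_ofNat]
  ring

theorem wirt_conj (f : (Fin n → ℂ) → ℂ) (x : Fin n → ℂ) (j : Fin n) :
    wirt j (fun y => conj (f y)) x = conj (wirtBar j f x) := by
  have h := wirtBar_conj (fun y => conj (f y)) x j
  simp only [conj_conj] at h
  rw [h, conj_conj]

theorem hasFDerivAt_fderiv_apply (hf : ContDiffAt ℝ 2 f x) (w : Fin n → ℂ) :
    HasFDerivAt (fun y => fderiv ℝ f y w) ((fderiv ℝ (fderiv ℝ f) x).flip w) x := by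
  have hd : DifferentiableAt ℝ (fderiv ℝ f) x :=
    (hf.fderiv_right (m := 1) (by norm_num)).differentiableAt (by simp)
  simpa using! hd.hasFDerivAt.clm_apply (hasFDerivAt_const w x)

theorem fderiv_wirtBar (hf : ContDiffAt ℝ 2 f x) (j : Fin n) (v : Fin n → ℂ) :
    fderiv ℝ (wirtBar j f) x v = (fderiv ℝ (fderiv ℝ f) x v (Pi.single j 1) +
      I * fderiv ℝ (fderiv ℝ f) x v (Pi.single j I)) / 2 := by
  have h := hasFDerivAt_fderiv_apply hf
  have h1 : HasFDerivAt (wirtBar j f) _ x :=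
    ((h (Pi.single j 1)).add ((h (Pi.single j I)).const_mul I)).mul_const (2⁻¹ : ℂ)
  rw [h1.fderiv]
  simp
  ring

theorem fderiv_wirt (hf : ContDiffAt ℝ 2 f x) (j : Fin n) (v : Fin n → ℂ) :
    fderiv ℝ (wirt j f) x v = (fderiv ℝ (fderiv ℝ f) x v (Pi.single j 1) -
      I * fderiv ℝ (fderiv ℝ f) x v (Pi.single j I)) / 2 := by
  have h := hasFDerivAt_fderiv_apply hf
  have h1 : HasFDerivAt (wirt j f) _ x :=
    ((h (Pi.single j 1)).sub ((h (Pi.single j I)).const_mul I)).mul_const (2⁻¹ : ℂ)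
  rw [h1.fderiv]
  simp
  ring

theorem wirtBar_comm (hf : ContDiffAt ℝ 2 f x) (i j : Fin n) :
    wirtBar i (wirtBar j f) x = wirtBar j (wirtBar i f) x := by
  have hs : IsSymmSndFDerivAt ℝ f x := hf.isSymmSndFDerivAt (by simp)
  rw [wirtBar, wirtBar]
  simp only [fderiv_wirtBar hf]
  rw [hs.eq (Pi.single i 1) (Pi.single j 1), hs.eq (Pi.single i 1) (Pi.single j I),
    hs.eq (Pi.single i I) (Pi.single j 1), hs.eq (Pi.single i I) (Pi.single j I)]
  ring

theorem wirt_wirtBar_comm (hf : ContDiffAt ℝ 2 f x) (i j : Fin n) :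
    wirt i (wirtBar j f) x = wirtBar j (wirt i f) x := by
  have hs : IsSymmSndFDerivAt ℝ f x := hf.isSymmSndFDerivAt (by simp)
  rw [wirt, wirtBar]
  simp only [fderiv_wirtBar hf, fderiv_wirt hf]
  rw [hs.eq (Pi.single i 1) (Pi.single j 1), hs.eq (Pi.single i 1) (Pi.single j I),
    hs.eq (Pi.single i I) (Pi.single j 1), hs.eq (Pi.single i I) (Pi.single j I)]
  ring

theorem wirtBar_eq_zero_of_differentiableAt (hf : DifferentiableAt ℂ f x) (j : Fin n) :
    wirtBar j f x = 0 := by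
  have h1 : fderiv ℝ f x = (fderiv ℂ f x).restrictScalars ℝ :=
    (hf.hasFDerivAt.restrictScalars ℝ).fderiv
  have h2 : (Pi.single j I : Fin n → ℂ) = I • Pi.single j 1 := by
    rw [← Pi.single_smul]
    simp
  rw [wirtBar, h1, ContinuousLinearMap.coe_restrictScalars', h2, map_smul, smul_eq_mul]
  linear_combination (fderiv ℂ f x (Pi.single j 1) / 2) * I_sq

end WirtingerCalculus

section BochnerFormal
open Set Filter Topology Metric
open scoped ContDiff

theorem contDiff_min_zero_pow (m : ℕ) : ContDiff ℝ m fun t : ℝ => min t 0 ^ (m + 1) := by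
  induction m with
  | zero => exact contDiff_zero.2 (by fun_prop)
  | succ m ih =>
    have h : ∀ t : ℝ, HasDerivAt (fun t : ℝ => min t 0 ^ (m + 1 + 1))
        ((m + 2) * min t 0 ^ (m + 1)) t := by
      refine fun t => hasDerivAt_of_hasDerivAt_of_ne' (x := 0) (fun t ht => ?_)
        (Continuous.continuousAt (by fun_prop)) (Continuous.continuousAt
          (f := fun t : ℝ => ((m : ℝ) + 2) * min t 0 ^ (m + 1)) (by fun_prop)) t
      rcases lt_or_gt_of_ne ht with h | h
      · have h1 : HasDerivAt (fun t : ℝ => t ^ (m + 1 + 1)) ((m + 2) * t ^ (m + 1)) t := by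
          refine (hasDerivAt_pow (m + 1 + 1) t).congr_deriv ?_
          rw [Nat.add_sub_cancel]
          push_cast
          ring
        rw [min_eq_left h.le]
        refine h1.congr_of_eventuallyEq ?_
        filter_upwards [gt_mem_nhds h] with s hs
        rw [min_eq_left hs.le]
      · rw [min_eq_right h.le, zero_pow (by omega), mul_zero]
        refine (hasDerivAt_const t (0 : ℝ)).congr_of_eventuallyEq ?_
        filter_upwards [lt_mem_nhds h] with s hs
        rw [min_eq_right hs.le, zero_pow (by omega)]
    push_cast
    rw [contDiff_succ_iff_deriv]
    refine ⟨fun t => (h t).differentiableAt, by simp, ?_⟩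
    rw [show deriv (fun t : ℝ => min t 0 ^ (m + 1 + 1)) = fun t : ℝ => (m + 2) * min t 0 ^ (m + 1) from
      funext fun t => (h t).deriv]
    exact contDiff_const.mul ih

variable {n : ℕ}

theorem contDiff_ofReal_comp {ρ : (Fin n → ℂ) → ℝ} {m : ℕ∞ω} (hρ : ContDiff ℝ m ρ) :
    ContDiff ℝ m fun y => (ρ y : ℂ) := Complex.ofRealCLM.contDiff.comp hρ

theorem fderiv_ofReal_comp {ρ : (Fin n → ℂ) → ℝ} {x : Fin n → ℂ} (hρ : DifferentiableAt ℝ ρ x)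
    (v : Fin n → ℂ) : fderiv ℝ (fun y => (ρ y : ℂ)) x v = (fderiv ℝ ρ x v : ℂ) := by
  have h : HasFDerivAt (fun y => (ρ y : ℂ)) _ x := Complex.ofRealCLM.hasFDerivAt.comp x hρ.hasFDerivAt
  rw [h.fderiv]
  simp

theorem wirt_ofReal_comp (ρ : (Fin n → ℂ) → ℝ) (x : Fin n → ℂ) (j : Fin n) :
    wirt j (fun y => (ρ y : ℂ)) x = conj (wirtBar j (fun y => (ρ y : ℂ)) x) := by
  simpa using wirt_conj (fun y => (ρ y : ℂ)) x j

theorem exists_wirtBar_ne_zero {ρ : (Fin n → ℂ) → ℝ} {x : Fin n → ℂ} (hx : fderiv ℝ ρ x ≠ 0) :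
    ∃ j, wirtBar j (fun y => (ρ y : ℂ)) x ≠ 0 := by
  by_contra! h
  have hd : DifferentiableAt ℝ ρ x := by
    by_contra h
    exact hx (fderiv_zero_of_not_differentiableAt h)
  refine hx (ContinuousLinearMap.ext fun v => ?_)
  have h1 := fderiv_eq_sum_wirt (fun y => (ρ y : ℂ)) x v
  simpa [fderiv_ofReal_comp hd, wirt_ofReal_comp, h] using h1

/-- A smooth family dual to the `(0,1)`-differential of a defining function. -/
theorem exists_dual_wirtBar {ρ : (Fin n → ℂ) → ℝ} (hρ : ContDiff ℝ ∞ ρ)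
    (hreg : ∀ x, ρ x = 0 → fderiv ℝ ρ x ≠ 0) :
    ∃ a : Fin n → (Fin n → ℂ) → ℂ, (∀ j, ContDiff ℝ ∞ (a j)) ∧
      ∀ x, ρ x = 0 → ∑ j, a j x * wirtBar j (fun y => (ρ y : ℂ)) x = 1 := by
  let b : Fin n → (Fin n → ℂ) → ℂ := fun j => wirtBar j fun y => (ρ y : ℂ)
  have hb : ∀ j, ContDiff ℝ ∞ (b j) := fun j => contDiff_wirtBar (contDiff_ofReal_comp hρ) (by simp) j
  have hbc : ∀ j, ContDiff ℝ ∞ fun x => conj (b j x) := fun j =>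
    (conjCLE : ℂ ≃L[ℝ] ℂ).contDiff.comp (hb j)
  let d : (Fin n → ℂ) → ℂ := fun x => ∑ j, conj (b j x) * b j x + (ρ x : ℂ) ^ 2
  have hd : ContDiff ℝ ∞ d :=
    (ContDiff.sum fun j _ => (hbc j).mul (hb j)).add ((contDiff_ofReal_comp hρ).pow 2)
  have hd' : ∀ x, d x = ((∑ j, ‖b j x‖ ^ 2 + ρ x ^ 2 : ℝ) : ℂ) := by
    intro x
    simp [d, Complex.conj_mul']
  have hd0 : ∀ x, d x ≠ 0 := by
    intro x
    rw [hd']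
    have h1 : 0 ≤ ∑ j, ‖b j x‖ ^ 2 := Finset.sum_nonneg fun _ _ => by positivity
    refine ofReal_ne_zero.2 (ne_of_gt ?_)
    by_cases hx : ρ x = 0
    · obtain ⟨j, hj⟩ := exists_wirtBar_ne_zero (hreg x hx)
      have h2 : 0 < ∑ j, ‖b j x‖ ^ 2 := Finset.sum_pos' (fun _ _ => by positivity)
        ⟨j, Finset.mem_univ j, by have : 0 < ‖b j x‖ := norm_pos_iff.2 hj
                                  positivity⟩
      positivity
    · have : 0 < ρ x ^ 2 := by positivity
      positivity
  refine ⟨fun j x => conj (b j x) / d x, fun j => by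
    simp only [div_eq_mul_inv]
    exact (hbc j).mul (hd.inv hd0), fun x hx => ?_⟩
  have : ∑ j, conj (b j x) * b j x = d x := by simp [d, hx]
  simp_rw [div_mul_eq_mul_div]
  rw [← Finset.sum_div]
  change (∑ j, conj (b j x) * b j x) / d x = 1
  rw [this, div_self (hd0 x)]

theorem dense_ne_zero {ρ : (Fin n → ℂ) → ℝ} (hreg : ∀ x, ρ x = 0 → fderiv ℝ ρ x ≠ 0) :
    Dense {x | ρ x ≠ 0} := by
  intro x
  by_cases hx : ρ x = 0
  · exact closure_mono (fun y hy => ne_of_lt (show ρ y < 0 from hy)) (mem_closure_neg hx (hreg x hx))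
  · exact subset_closure hx

/-- A CR function on a real hypersurface `{ρ = 0}` admits smooth extensions whose
`∂̄`-derivatives vanish to any prescribed order on the hypersurface. -/
theorem exists_wirtBar_eq_pow_mul {ρ : (Fin n → ℂ) → ℝ} (hρ : ContDiff ℝ ∞ ρ)
    (hreg : ∀ x, ρ x = 0 → fderiv ℝ ρ x ≠ 0) {f : (Fin n → ℂ) → ℂ} (hf : ContDiff ℝ ∞ f)
    (hCR : IsCROn ρ {x | ρ x = 0} f) (k : ℕ) :
    ∃ (u : (Fin n → ℂ) → ℂ) (θ : Fin n → (Fin n → ℂ) → ℂ), ContDiff ℝ ∞ u ∧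
      (∀ j, ContDiff ℝ ∞ (θ j)) ∧ (∀ j x, wirtBar j u x = (ρ x : ℂ) ^ k * θ j x) ∧
      ∀ x, ρ x = 0 → u x = f x := by
  let b : Fin n → (Fin n → ℂ) → ℂ := fun j => wirtBar j fun y => (ρ y : ℂ)
  have hρc := contDiff_ofReal_comp hρ
  have hρd : Differentiable ℝ fun y => (ρ y : ℂ) := hρc.differentiable (by simp)
  have hb : ∀ j, ContDiff ℝ ∞ (b j) := fun j => contDiff_wirtBar hρc (by simp) j
  obtain ⟨a, ha, hab⟩ := exists_dual_wirtBar hρ hreg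
  suffices H : ∃ (u : (Fin n → ℂ) → ℂ) (θ : Fin n → (Fin n → ℂ) → ℂ), ContDiff ℝ ∞ u ∧
      (∀ j, ContDiff ℝ ∞ (θ j)) ∧ (∀ j x, wirtBar j u x = (ρ x : ℂ) ^ k * θ j x) ∧
      (∀ x, ρ x = 0 → u x = f x) ∧ ∀ x, ρ x = 0 → ∀ i j, b j x * θ i x = b i x * θ j x by
    obtain ⟨u, θ, h1, h2, h3, h4, -⟩ := H
    exact ⟨u, θ, h1, h2, h3, h4⟩
  induction k with
  | zero =>
    refine ⟨f, fun j => wirtBar j f, hf, fun j => contDiff_wirtBar hf (by simp) j,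
      fun j x => by simp, fun _ _ => rfl, fun x hx i j => ?_⟩
    have h1 := hCR x hx (Pi.single i (b j x) - Pi.single j (b i x)) (by
      simp [sub_mul, Finset.sum_sub_distrib, Pi.single_apply, ite_mul, b]
      ring)
    simp only [Pi.sub_apply, sub_mul, Finset.sum_sub_distrib, Pi.single_apply, ite_mul, zero_mul,
      Finset.sum_ite_eq', Finset.mem_univ, if_true] at h1
    exact sub_eq_zero.1 h1
  | succ k ih =>
    obtain ⟨u, θ, hu, hθ, huθ, huf, hcomp⟩ := ih
    let h : (Fin n → ℂ) → ℂ := fun x => ∑ i, a i x * θ i x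
    have hh : ContDiff ℝ ∞ h := ContDiff.sum fun i _ => (ha i).mul (hθ i)
    have hhd : Differentiable ℝ h := hh.differentiable (by simp)
    have h0 : ∀ j x, ρ x = 0 → θ j x - h x * b j x = 0 := by
      intro j x hx
      have h1 : h x * b j x = ∑ i, a i x * b i x * θ j x := by
        simp only [h, Finset.sum_mul]
        refine Finset.sum_congr rfl fun i _ => ?_
        linear_combination (a i x) * hcomp x hx i j
      rw [h1, ← Finset.sum_mul, hab x hx]
      ring
    choose θ' hθ' hθθ' using fun j => exists_contDiff_eq_smul hρ hreg
      ((hθ j).sub (hh.mul (hb j))) (h0 j)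
    let u' : (Fin n → ℂ) → ℂ := fun x => u x - (h x / (k + 1)) * (ρ x : ℂ) ^ (k + 1)
    have hhk : ContDiff ℝ ∞ fun x => h x / (k + 1) := hh.div_const _
    have hu' : ContDiff ℝ ∞ u' := hu.sub (hhk.mul (hρc.pow (k + 1)))
    let ψ : Fin n → (Fin n → ℂ) → ℂ := fun j x => θ' j x - wirtBar j (fun x => h x / (k + 1)) x
    have hψ : ∀ j, ContDiff ℝ ∞ (ψ j) := fun j =>
      (hθ' j).sub (contDiff_wirtBar hhk (by simp) j)
    have hk : (k + 1 : ℂ) ≠ 0 := by exact_mod_cast k.succ_ne_zero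
    have huψ : ∀ j x, wirtBar j u' x = (ρ x : ℂ) ^ (k + 1) * ψ j x := by
      intro j x
      have hpd : DifferentiableAt ℝ (fun y => (ρ y : ℂ) ^ (k + 1)) x := (hρd x).pow _
      have hkd : DifferentiableAt ℝ (fun x => h x / (k + 1)) x := hhk.differentiable (by simp) x
      simp only [u', ψ]
      rw [wirtBar_sub (hu.differentiable (by simp) x) (hkd.fun_mul hpd), wirtBar_mul hkd hpd,
        wirtBar_pow (hρd x), huθ]
      have h2 := hθθ' j x
      rw [Complex.real_smul] at h2
      have h3 : wirtBar j (fun y => (ρ y : ℂ)) x = b j x := rfl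
      have h4 : h x / (k + 1) * ((k + 1) * (ρ x : ℂ) ^ k * b j x) = h x * (ρ x : ℂ) ^ k * b j x := by
        field_simp
      rw [h3, h4]
      linear_combination (ρ x : ℂ) ^ k * h2
    refine ⟨u', ψ, hu', hψ, huψ, fun x hx => by simp [u', hx, huf x hx], ?_⟩
    have hbc : ∀ j, Continuous (b j) := fun j => (hb j).continuous
    have hψc : ∀ j, Continuous (ψ j) := fun j => (hψ j).continuous
    have hψwc : ∀ i j, Continuous (wirtBar i (ψ j)) := fun i j =>
      (contDiff_wirtBar (k := 0) (hψ j) (by simp) i).continuous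
    have key : ∀ i j, (fun x => (k + 1) * (b j x * ψ i x - b i x * ψ j x))
        = fun x => (ρ x : ℂ) * (wirtBar i (ψ j) x - wirtBar j (ψ i) x) := by
      intro i j
      have := hρc.continuous
      have := hbc i
      have := hbc j
      have := hψc i
      have := hψc j
      have := hψwc i j
      have := hψwc j i
      refine Continuous.ext_on (dense_ne_zero hreg) (by fun_prop) (by fun_prop) fun x hx => ?_
      have h5 := wirtBar_comm (hu'.contDiffAt.of_le (by norm_cast) : ContDiffAt ℝ 2 u' x) i j
      have h6 : ∀ i j, wirtBar i (wirtBar j u') x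
          = (ρ x : ℂ) ^ (k + 1) * wirtBar i (ψ j) x + ψ j x * ((k + 1) * (ρ x : ℂ) ^ k * b i x) := by
        intro i j
        rw [show wirtBar j u' = fun x => (ρ x : ℂ) ^ (k + 1) * ψ j x from funext (huψ j),
          wirtBar_mul ((hρd x).fun_pow _) ((hψ j).differentiable (by simp) x), wirtBar_pow (hρd x)]
      rw [h6, h6] at h5
      have h7 : (ρ x : ℂ) ^ k ≠ 0 := pow_ne_zero _ (ofReal_ne_zero.2 hx)
      refine mul_left_cancel₀ h7 ?_
      linear_combination -h5
    intro x hx i j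
    have h8 := congrFun (key i j) x
    simp only [hx, ofReal_zero, zero_mul] at h8
    exact sub_eq_zero.1 ((mul_eq_zero.1 h8).resolve_left hk)

end BochnerFormal

section Bochner
open Set Filter Topology Metric
open scoped ContDiff
variable {n : ℕ}

theorem exists_contDiff_holomorphic_extension (hn : 2 ≤ n) {ρ : (Fin n → ℂ) → ℝ}
    (hρ : ContDiff ℝ ∞ ρ) (hreg : ∀ x, ρ x = 0 → fderiv ℝ ρ x ≠ 0)
    (hbdd : Bornology.IsBounded {x | ρ x < 0}) (hconn : IsConnected {x | ρ x = 0})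
    {f : (Fin n → ℂ) → ℂ} (hf : ContDiff ℝ ∞ f) (hCR : IsCROn ρ {x | ρ x = 0} f)
    {m : ℕ} (hm : 1 ≤ m) :
    ∃ F : (Fin n → ℂ) → ℂ, ContDiff ℝ m F ∧ (∀ x, ρ x < 0 → DifferentiableAt ℂ F x) ∧
      ∀ x, ρ x = 0 → F x = f x := by
  obtain ⟨u, θ, hu, hθ, huθ, huf⟩ := exists_wirtBar_eq_pow_mul hρ hreg hf hCR (m + 1)
  let g : Fin n → (Fin n → ℂ) → ℂ := fun j x => ((min (ρ x) 0 ^ (m + 1) : ℝ) : ℂ) * θ j x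
  have hg : ∀ j, ContDiff ℝ m (g j) := fun j =>
    (contDiff_ofReal_comp ((contDiff_min_zero_pow m).comp
      (hρ.of_le (by exact_mod_cast le_top)))).mul ((hθ j).of_le (by exact_mod_cast le_top))
  have hg₀ : ∀ j x, 0 ≤ ρ x → g j x = 0 := by
    intro j x hx
    simp [g, min_eq_right hx]
  have hgu : ∀ j x, ρ x < 0 → g j x = wirtBar j u x := by
    intro j x hx
    simp [g, min_eq_left hx.le, huθ]
  have hm' : (0 : ℕ∞ω) + 1 ≤ m := by
    rw [zero_add]
    exact_mod_cast hm
  have hcompat : ∀ j k x, wirtBar j (g k) x = wirtBar k (g j) x := by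
    intro j k
    refine fun x => congrFun (Continuous.ext_on (dense_ne_zero hreg)
      (contDiff_wirtBar (hg k) hm' j).continuous
      (contDiff_wirtBar (hg j) hm' k).continuous fun x hx => ?_) x
    rcases lt_or_gt_of_ne (show ρ x ≠ 0 from hx) with h | h
    · have h1 : ∀ j, g j =ᶠ[𝓝 x] wirtBar j u := by
        intro j
        filter_upwards [hρ.continuous.continuousAt.eventually (gt_mem_nhds h)] with y hy
        exact hgu j y hy
      rw [(h1 k).wirtBar_eq, (h1 j).wirtBar_eq]
      exact wirtBar_comm (hu.contDiffAt.of_le (by norm_cast)) j k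
    · have h1 : ∀ j, g j =ᶠ[𝓝 x] fun _ => 0 := by
        intro j
        filter_upwards [hρ.continuous.continuousAt.eventually (lt_mem_nhds h)] with y hy
        exact hg₀ j y (le_of_lt hy)
      rw [(h1 k).wirtBar_eq, (h1 j).wirtBar_eq]
      simp [wirtBar]
  obtain ⟨v, hv, hvg, hv₀⟩ := exists_wirtBar_eq_of_eq_zero_outside hn hρ hreg hbdd hconn
    (m := m) (by exact_mod_cast hm) hg hg₀ hcompat
  have hvd : Differentiable ℝ v := hv.differentiable (by
    have : m ≠ 0 := by omega
    exact_mod_cast this)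
  have hud : Differentiable ℝ u := hu.differentiable (by simp)
  refine ⟨fun x => u x - v x, (hu.of_le (by exact_mod_cast le_top)).sub hv, fun x hx => ?_,
    fun x hx => by simp [huf x hx, hv₀ x hx.ge]⟩
  refine differentiableAt_of_wirtBar_eq_zero ((hud x).fun_sub (hvd x)) fun j => ?_
  rw [wirtBar_sub (hud x) (hvd x), hvg, hgu j x hx, sub_self]

/-- **Bochner's extension theorem** with smoothness up to the boundary: a smooth CR function on a
connected compact hypersurface in `ℂⁿ`, `n ≥ 2`, extends holomorphically to the inside. -/
theorem exists_holomorphic_extension (hn : 2 ≤ n) {ρ : (Fin n → ℂ) → ℝ}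
    (hρ : ContDiff ℝ ∞ ρ) (hreg : ∀ x, ρ x = 0 → fderiv ℝ ρ x ≠ 0)
    (hbdd : Bornology.IsBounded {x | ρ x < 0}) (hconn : IsConnected {x | ρ x = 0})
    {f : (Fin n → ℂ) → ℂ} (hf : ContDiff ℝ ∞ f) (hCR : IsCROn ρ {x | ρ x = 0} f) :
    ∃ F : (Fin n → ℂ) → ℂ, ContDiffOn ℝ ∞ F (closure {x | ρ x < 0}) ∧
      (∀ x, ρ x < 0 → DifferentiableAt ℂ F x) ∧ ∀ x, ρ x = 0 → F x = f x := by
  choose F hF hFd hFf using fun m : ℕ => exists_contDiff_holomorphic_extension hn hρ hreg hbdd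
    hconn hf hCR (m := m + 1) (by omega)
  have hopen : IsOpen {x | ρ x < 0} := isOpen_lt hρ.continuous continuous_const
  have hdc : ∀ m, DiffContOnCl ℂ (F m) {x | ρ x < 0} := fun m =>
    ⟨fun x hx => (hFd m x hx).differentiableWithinAt, (hF m).continuous.continuousOn⟩
  have heq : ∀ m, EqOn (F 0) (F m) (closure {x | ρ x < 0}) := by
    intro m
    have : Nonempty (Fin n) := ⟨⟨0, by omega⟩⟩
    refine Complex.eqOn_closure_of_eqOn_frontier hbdd (hdc 0) (hdc m) fun x hx => ?_
    rw [hopen.frontier_eq, closure_neg_eq hρ.continuous hreg] at hx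
    have hx0 : ρ x = 0 := le_antisymm hx.1 (not_lt.1 hx.2)
    rw [hFf 0 x hx0, hFf m x hx0]
  refine ⟨F 0, contDiffOn_infty.2 fun m => ?_, hFd 0, hFf 0⟩
  exact ((hF m).contDiffOn.congr (heq m)).of_le (by exact_mod_cast m.le_succ)

/-- If two functions on a hypersurface extend holomorphically inside, then the sum of one and the
conjugate of the other extends pluriharmonically. -/
theorem exists_pluriharmonic_extension (hn : 2 ≤ n) {ρ : (Fin n → ℂ) → ℝ}
    (hρ : ContDiff ℝ ∞ ρ) (hreg : ∀ x, ρ x = 0 → fderiv ℝ ρ x ≠ 0)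
    (hbdd : Bornology.IsBounded {x | ρ x < 0}) (hconn : IsConnected {x | ρ x = 0})
    {f g : (Fin n → ℂ) → ℂ} (hf : ContDiff ℝ ∞ f) (hg : ContDiff ℝ ∞ g)
    (hfCR : IsCROn ρ {x | ρ x = 0} f) (hgCR : IsCROn ρ {x | ρ x = 0} fun y => conj (g y)) :
    ∃ U : (Fin n → ℂ) → ℂ, ContDiffOn ℝ ∞ U (closure {x | ρ x < 0}) ∧
      (∀ x, ρ x < 0 → ∀ j k : Fin n, wirt j (fun y => wirtBar k U y) x = 0) ∧
      ∀ x, ρ x = 0 → U x = f x + g x := by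
  have hconj : ContDiff ℝ ∞ (conj : ℂ → ℂ) := (conjCLE : ℂ ≃L[ℝ] ℂ).contDiff
  obtain ⟨F, hF, hFd, hFf⟩ := exists_holomorphic_extension hn hρ hreg hbdd hconn hf hfCR
  obtain ⟨G, hG, hGd, hGf⟩ := exists_holomorphic_extension hn hρ hreg hbdd hconn
    (hconj.comp hg) hgCR
  refine ⟨fun x => F x - -conj (G x), hF.sub (hconj.comp_contDiffOn hG).neg, fun x hx j k => ?_,
    fun x hx => by simp [hFf x hx, hGf x hx]⟩
  have hopen : IsOpen {x | ρ x < 0} := isOpen_lt hρ.continuous continuous_const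
  have hnear : ∀ᶠ y in 𝓝 x, ρ y < 0 := hopen.mem_nhds hx
  have hG2 : ContDiffAt ℝ 2 G x :=
    (hG.contDiffAt (mem_of_superset (hopen.mem_nhds hx) subset_closure)).of_le (by norm_cast)
  have h1 : (fun y => wirtBar k (fun x => F x - -conj (G x)) y) =ᶠ[𝓝 x]
      fun y => conj (wirt k G y) := by
    filter_upwards [hnear] with y hy
    have h2 : DifferentiableAt ℝ (fun x => conj (G x)) y :=
      (conjCLE : ℂ ≃L[ℝ] ℂ).differentiableAt.comp y ((hGd y hy).restrictScalars ℝ)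
    rw [wirtBar_sub ((hFd y hy).restrictScalars ℝ) h2.fun_neg,
      wirtBar_eq_zero_of_differentiableAt (hFd y hy), ← wirtBar_conj]
    simp [wirtBar]
    ring
  have h3 : wirt j (fun y => wirtBar k (fun x => F x - -conj (G x)) y) x
      = wirt j (fun y => conj (wirt k G y)) x := by
    rw [wirt, wirt, h1.fderiv_eq]
  have h4 : wirtBar j G =ᶠ[𝓝 x] fun _ => 0 := by
    filter_upwards [hnear] with y hy
    exact wirtBar_eq_zero_of_differentiableAt (hGd y hy) j
  rw [h3, wirt_conj, ← wirt_wirtBar_comm hG2, wirt, h4.fderiv_eq]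
  simp

end Bochner

section TangentialPrimitive
open Set Filter Topology Metric
open scoped ContDiff
variable {E : Type*} [NormedAddCommGroup E] [NormedSpace ℝ E]
  {F : Type*} [NormedAddCommGroup F] [NormedSpace ℝ F]

/-- A closed one-form which is smooth up to the boundary has a closed derivative there. -/
theorem fderivWithin_symmetric_of_closure {Ω : Set E} (hΩ : IsOpen Ω)
    (hu : UniqueDiffOn ℝ (closure Ω)) {α : E → E →L[ℝ] F}
    (hα : ContDiffOn ℝ ∞ α (closure Ω))
    (hsymm : ∀ x ∈ Ω, ∀ v w, fderiv ℝ α x v w = fderiv ℝ α x w v) {x : E} (hx : x ∈ closure Ω)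
    (v w : E) : fderivWithin ℝ α (closure Ω) x v w = fderivWithin ℝ α (closure Ω) x w v := by
  have hc : ContinuousOn (fderivWithin ℝ α (closure Ω)) (closure Ω) :=
    (hα.fderivWithin (m := 0) hu (by simp)).continuousOn
  have h (v w : E) : ContinuousOn (fun x => fderivWithin ℝ α (closure Ω) x v w) (closure Ω) :=
    (hc.clm_apply continuousOn_const).clm_apply continuousOn_const
  refine EqOn.of_subset_closure (fun y hy => ?_) (h v w) (h w v) subset_closure subset_rfl hx
  have : closure Ω ∈ 𝓝 y := mem_of_superset (hΩ.mem_nhds hy) subset_closure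
  simp only [fderivWithin_of_mem_nhds this]
  exact hsymm y hy v w

variable [FiniteDimensional ℝ E]

theorem fderiv_apply_of_retraction {ρ : E → ℝ} (hρ : ContDiff ℝ ∞ ρ) {r : E → E} {U : Set E}
    (hU : IsOpen U) (hr : DifferentiableOn ℝ r U) (hrid : ∀ x ∈ U, ρ x = 0 → r x = x) {y v : E}
    (hy : y ∈ U) (hy₀ : ρ y = 0) (hy₁ : fderiv ℝ ρ y ≠ 0) (hv : fderiv ℝ ρ y v = 0) :
    fderiv ℝ r y v = v := by
  have hd := hr.differentiableAt (hU.mem_nhds hy)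
  have h1 := fderiv_eq_zero_of_tangent hρ hy₀ hy₁ (w := fun x => r x - x)
    (hd.fun_sub differentiableAt_id) (by
      filter_upwards [hU.mem_nhds hy] with x hx hx₀
      rw [hrid x hx hx₀, sub_self]) hv
  have h2 : HasFDerivAt (fun x => r x - x) _ y := hd.hasFDerivAt.sub (hasFDerivAt_id y)
  rw [h2.fderiv] at h1
  simpa [sub_eq_zero] using h1

theorem exists_local_tangential_primitive [CompleteSpace F] {ρ : E → ℝ} (hρ : ContDiff ℝ ∞ ρ)
    (hreg : ∀ x, ρ x = 0 → fderiv ℝ ρ x ≠ 0) {α : E → E →L[ℝ] F}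
    (hα : ContDiffOn ℝ ∞ α (closure {x | ρ x < 0}))
    (hsymm : ∀ x, ρ x < 0 → ∀ v w, fderiv ℝ α x v w = fderiv ℝ α x w v) {p : E} (hp : ρ p = 0) :
    ∃ ε > 0, ∃ f : E → F, ContDiffOn ℝ ∞ f (ball p ε) ∧
      ∀ y ∈ ball p ε, ρ y = 0 → ∀ v, fderiv ℝ ρ y v = 0 → fderiv ℝ f y v = α y v := by
  obtain ⟨ε, hε, r, hr, hr₀, hrid, -⟩ := exists_smooth_retraction hρ hp (hreg p hp)
  have hu := uniqueDiffOn_closure_neg (hρ.differentiable (by simp)) hreg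
  have hΩ : IsOpen {x | ρ x < 0} := isOpen_lt hρ.continuous continuous_const
  have hmaps : ∀ x ∈ ball p ε, r x ∈ closure {x | ρ x < 0} := fun x hx =>
    mem_closure_neg (hr₀ x hx) (hreg _ (hr₀ x hx))
  have hrd : DifferentiableOn ℝ r (ball p ε) := hr.differentiableOn (by simp)
  have hr' : ContDiffOn ℝ ∞ (fderiv ℝ r) (ball p ε) :=
    ((contDiffOn_infty_iff_fderiv_of_isOpen isOpen_ball).1 hr).2
  set η : E → E →L[ℝ] F := fun x => (α (r x)).comp (fderiv ℝ r x) with hη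
  have hηs : ContDiffOn ℝ ∞ η (ball p ε) := (hα.comp hr hmaps).clm_comp hr'
  have hηsymm : ∀ x ∈ ball p ε, ∀ v w, fderiv ℝ η x v w = fderiv ℝ η x w v := by
    intro x hx v w
    have hxb : ball p ε ∈ 𝓝 x := isOpen_ball.mem_nhds hx
    have h1 : HasFDerivAt (α ∘ r) _ x :=
      ((hα.differentiableOn (by simp) _ (hmaps x hx)).hasFDerivWithinAt).comp_hasFDerivAt x
        (hrd.differentiableAt hxb).hasFDerivAt (by filter_upwards [hxb] using hmaps)
    have h2 : HasFDerivAt (fderiv ℝ r) _ x :=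
      ((hr'.contDiffAt hxb).differentiableAt (by simp)).hasFDerivAt
    have h3 : HasFDerivAt η _ x := h1.clm_comp h2
    have h4 : IsSymmSndFDerivAt ℝ r x :=
      ((hr.contDiffAt hxb).of_le (by norm_cast) : ContDiffAt ℝ 2 r x).isSymmSndFDerivAt (by simp)
    rw [h3.fderiv]
    simp only [add_apply, ContinuousLinearMap.comp_apply, ContinuousLinearMap.compL_apply,
      ContinuousLinearMap.flip_apply, Function.comp_apply]
    rw [h4.eq v w, fderivWithin_symmetric_of_closure hΩ hu hα hsymm (hmaps x hx)]
  obtain ⟨f, hf⟩ := (convex_ball p ε).exists_forall_hasFDerivAt_of_fderiv_symmetric isOpen_ball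
    (hηs.differentiableOn (by simp)) hηsymm
  refine ⟨ε, hε, f, ?_, ?_⟩
  · rw [contDiffOn_infty_iff_fderiv_of_isOpen isOpen_ball]
    exact ⟨fun x hx => (hf x hx).differentiableAt.differentiableWithinAt,
      hηs.congr fun x hx => (hf x hx).fderiv⟩
  · intro y hy hy₀ v hv
    rw [(hf y hy).fderiv, hη]
    simp only [ContinuousLinearMap.comp_apply]
    rw [fderiv_apply_of_retraction hρ isOpen_ball hrd hrid hy hy₀ (hreg y hy₀) hv, hrid y hy hy₀]

/-- A function with vanishing tangential derivative is locally constant on the level set. -/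
theorem eventually_eq_of_tangential_fderiv_eq_zero {ρ : E → ℝ} (hρ : ContDiff ℝ ∞ ρ)
    {x : E} (hx₀ : ρ x = 0) (hx : fderiv ℝ ρ x ≠ 0) {f : E → F}
    (hf : ∀ᶠ y in 𝓝 x, DifferentiableAt ℝ f y)
    (h : ∀ᶠ y in 𝓝 x, ρ y = 0 → ∀ v, fderiv ℝ ρ y v = 0 → fderiv ℝ f y v = 0) :
    ∀ᶠ y in 𝓝 x, ρ y = 0 → f y = f x := by
  obtain ⟨ε, hε, r, hr, hr₀, hrid, -⟩ := exists_smooth_retraction hρ hx₀ hx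
  have hxb : ball x ε ∈ 𝓝 x := ball_mem_nhds x hε
  have hrd : DifferentiableOn ℝ r (ball x ε) := hr.differentiableOn (by simp)
  have hrx : r x = x := hrid x (mem_ball_self hε) hx₀
  have ht : Tendsto r (𝓝 x) (𝓝 x) := by
    have := (hrd.differentiableAt hxb).continuousAt.tendsto
    rwa [hrx] at this
  obtain ⟨δ, hδ, hball⟩ := Metric.eventually_nhds_iff_ball.1 (ht.eventually (hf.and h) |>.and hxb)
  have hconst : ∀ y ∈ ball x δ, (f ∘ r) y = (f ∘ r) x := by
    intro z hz
    have hd : ∀ y ∈ ball x δ, HasFDerivAt (f ∘ r) ((fderiv ℝ f (r y)).comp (fderiv ℝ r y)) y := by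
      intro y hy
      obtain ⟨⟨h1, -⟩, h3⟩ := hball y hy
      exact h1.hasFDerivAt.comp y (hrd.differentiableAt (isOpen_ball.mem_nhds h3)).hasFDerivAt
    refine isOpen_ball.is_const_of_fderiv_eq_zero (𝕜 := ℝ) (convex_ball x δ).isPreconnected
      (fun y hy => (hd y hy).differentiableAt.differentiableWithinAt) (fun y hy => ?_) hz (mem_ball_self hδ)
    obtain ⟨⟨-, h2⟩, h3⟩ := hball y hy
    rw [(hd y hy).fderiv]
    ext v
    refine h2 (hr₀ y h3) _ ?_
    have h4 : ρ ∘ r =ᶠ[𝓝 y] fun _ => 0 := by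
      filter_upwards [isOpen_ball.mem_nhds h3] with z hz using hr₀ z hz
    have h5 := h4.fderiv_eq (𝕜 := ℝ)
    rw [fderiv_comp y (hρ.differentiable (by simp) _)
      (hrd.differentiableAt (isOpen_ball.mem_nhds h3))] at h5
    simpa using! DFunLike.congr_fun h5 v
  filter_upwards [ball_mem_nhds x hδ] with y hy hy₀
  have := hconst y hy
  rwa [Function.comp_apply, Function.comp_apply, hrid y (hball y hy).2 hy₀, hrx] at this

/-- A one-form closed on one side of a simply connected hypersurface and smooth up to it has a
primitive along the hypersurface. -/
theorem exists_tangential_primitive [CompleteSpace F] {ρ : E → ℝ} (hρ : ContDiff ℝ ∞ ρ)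
    (hreg : ∀ x, ρ x = 0 → fderiv ℝ ρ x ≠ 0) (hsc : SimplyConnectedSpace {x | ρ x = 0})
    {α : E → E →L[ℝ] F} (hα : ContDiffOn ℝ ∞ α (closure {x | ρ x < 0}))
    (hsymm : ∀ x, ρ x < 0 → ∀ v w, fderiv ℝ α x v w = fderiv ℝ α x w v) :
    ∃ f : E → F, ContDiff ℝ ∞ f ∧
      ∀ p, ρ p = 0 → ∀ v, fderiv ℝ ρ p v = 0 → fderiv ℝ f p v = α p v := by
  have hlpc := locallyPathConnectedSpace_levelSet hρ hreg
  choose ε hε φ hφ hφα using fun p : {x | ρ x = 0} =>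
    exists_local_tangential_primitive hρ hreg hα hsymm (show ρ p = 0 from p.2)
  obtain ⟨G, hG⟩ := exists_sub_locallyConstant (X := {x | ρ x = 0}) (A := F)
    (fun p => (↑) ⁻¹' ball (p : E) (ε p)) (fun p => isOpen_ball.preimage continuous_subtype_val)
    (fun p => mem_ball_self (hε p)) (fun p y => φ p y) (by
      rintro p q x ⟨hxp, hxq⟩
      have hp := isOpen_ball.mem_nhds (show (x : E) ∈ ball (p : E) (ε p) from hxp)
      have hq := isOpen_ball.mem_nhds (show (x : E) ∈ ball (q : E) (ε q) from hxq)
      have hd : ∀ᶠ y in 𝓝 (x : E), DifferentiableAt ℝ (φ p) y ∧ DifferentiableAt ℝ (φ q) y := by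
        filter_upwards [eventually_mem_nhds_iff.2 hp, eventually_mem_nhds_iff.2 hq] with y h1 h2
        exact ⟨((hφ p).contDiffAt h1).differentiableAt (by simp),
          ((hφ q).contDiffAt h2).differentiableAt (by simp)⟩
      have h := eventually_eq_of_tangential_fderiv_eq_zero hρ x.2 (hreg x x.2)
        (f := fun y => φ p y - φ q y) (hd.mono fun y h => h.1.fun_sub h.2) (by
          filter_upwards [hd, hp, hq] with y h1 hyp hyq hy₀ v hv
          rw [fderiv_fun_sub h1.1 h1.2, sub_apply, hφα p y hyp hy₀ v hv, hφα q y hyq hy₀ v hv,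
            sub_self])
      filter_upwards [continuous_subtype_val.continuousAt.eventually h] with y hy using hy y.2)
  obtain ⟨f, hf, hfG⟩ := exists_contDiff_forall_mem_convex_of_local (E := E) (F := F)
    (t := fun x => {y | ∀ h : ρ x = 0, y = G ⟨x, h⟩}) (by
      intro x
      by_cases hx : ρ x = 0
      · have : {y | ∀ h : ρ x = 0, y = G ⟨x, h⟩} = {G ⟨x, hx⟩} := by
          ext y
          exact ⟨fun h => h hx, fun h _ => h⟩
        rw [this]
        exact convex_singleton _
      · have : {y | ∀ h : ρ x = 0, y = G ⟨x, h⟩} = univ := by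
          ext y
          exact ⟨fun _ => trivial, fun _ h => absurd h hx⟩
        rw [this]
        exact convex_univ) (by
      intro x
      by_cases hx : ρ x = 0
      · have h1 := hG ⟨x, hx⟩ ⟨x, hx⟩ (mem_ball_self (hε _))
        obtain ⟨V, hV, hVG⟩ := mem_nhds_subtype _ _ _ |>.1 h1
        refine ⟨V ∩ ball x (ε ⟨x, hx⟩), inter_mem hV (ball_mem_nhds x (hε _)),
          fun y => φ ⟨x, hx⟩ y + (G ⟨x, hx⟩ - φ ⟨x, hx⟩ x),
          ((hφ ⟨x, hx⟩).mono inter_subset_right).add contDiffOn_const, fun y hy hy₀ => ?_⟩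
        have h2 : G ⟨y, hy₀⟩ - φ ⟨x, hx⟩ y = G ⟨x, hx⟩ - φ ⟨x, hx⟩ x :=
          hVG (show ((⟨y, hy₀⟩ : {x | ρ x = 0}) : E) ∈ V from hy.1)
        rw [← h2]
        exact add_sub_cancel _ _
      · refine ⟨{y | ρ y ≠ 0}, (isOpen_ne_fun hρ.continuous continuous_const).mem_nhds hx,
          fun _ => 0, contDiffOn_const, fun y hy h => absurd h hy⟩)
  refine ⟨f, hf, fun p hp v hv => ?_⟩
  have hpb := ball_mem_nhds p (hε ⟨p, hp⟩)
  have hφd : DifferentiableAt ℝ (φ ⟨p, hp⟩) p :=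
    ((hφ ⟨p, hp⟩).contDiffAt hpb).differentiableAt (by simp)
  have hfd : DifferentiableAt ℝ f p := hf.differentiable (by simp) p
  obtain ⟨V, hV, hVG⟩ := mem_nhds_subtype _ _ _ |>.1 (hG ⟨p, hp⟩ ⟨p, hp⟩ (mem_ball_self (hε _)))
  have h1 := fderiv_eq_zero_of_tangent hρ hp (hreg p hp)
    (w := fun y => (f y - φ ⟨p, hp⟩ y) - (f p - φ ⟨p, hp⟩ p))
    ((hfd.fun_sub hφd).sub_const _) (by
      filter_upwards [hV] with y hy hy₀
      have h2 : G ⟨y, hy₀⟩ - φ ⟨p, hp⟩ y = G ⟨p, hp⟩ - φ ⟨p, hp⟩ p :=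
        hVG (show ((⟨y, hy₀⟩ : {x | ρ x = 0}) : E) ∈ V from hy)
      rw [hfG y hy₀, hfG p hp, h2, sub_self]) hv
  rw [fderiv_sub_const, fderiv_fun_sub hfd hφd, sub_apply, sub_eq_zero] at h1
  rw [h1, hφα ⟨p, hp⟩ p (mem_ball_self (hε _)) hp v hv]

end TangentialPrimitive

section PluriharmonicDecomposition
open Set Filter Topology Metric
open scoped ContDiff

theorem exists_eq_mul_of_ker {E : Type*} [NormedAddCommGroup E] [NormedSpace ℝ E]
    {ℓ : E →L[ℝ] ℝ} (hℓ : ℓ ≠ 0) (M : E →L[ℝ] ℂ) (h : ∀ v, ℓ v = 0 → M v = 0) :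
    ∃ c : ℂ, ∀ v, M v = c * ℓ v := by
  obtain ⟨e, he⟩ : ∃ e, ℓ e ≠ 0 := by
    by_contra! h
    exact hℓ (ContinuousLinearMap.ext h)
  refine ⟨M e / ℓ e, fun v => ?_⟩
  have h1 := h (v - (ℓ v / ℓ e) • e) (by simp [he])
  rw [map_sub, map_smul, sub_eq_zero, real_smul] at h1
  rw [h1]
  push_cast
  ring

variable {n : ℕ}

theorem wirt_comm {f : (Fin n → ℂ) → ℂ} {x : Fin n → ℂ} (hf : ContDiffAt ℝ 2 f x)
    (i j : Fin n) : wirt i (wirt j f) x = wirt j (wirt i f) x := by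
  have hs : IsSymmSndFDerivAt ℝ f x := hf.isSymmSndFDerivAt (by simp)
  rw [wirt, wirt]
  simp only [fderiv_wirt hf]
  rw [hs.eq (Pi.single i 1) (Pi.single j 1), hs.eq (Pi.single i 1) (Pi.single j I),
    hs.eq (Pi.single i I) (Pi.single j 1), hs.eq (Pi.single i I) (Pi.single j I)]
  ring

theorem isCROn_of_forall_exists_mul {ρ : (Fin n → ℂ) → ℝ} {S : Set (Fin n → ℂ)}
    {f : (Fin n → ℂ) → ℂ}
    (h : ∀ x ∈ S, ∃ c, ∀ j, wirtBar j f x = c * wirtBar j (fun y => (ρ y : ℂ)) x) :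
    IsCROn ρ S f := by
  intro x hx a ha
  obtain ⟨c, hc⟩ := h x hx
  simp only [hc, mul_left_comm _ c, ← Finset.mul_sum, ha, mul_zero]

/-- The coefficients of `∂U`, up to the boundary of `K`. -/
noncomputable def wirtWithin (K : Set (Fin n → ℂ)) (U : (Fin n → ℂ) → ℂ) (j : Fin n)
    (x : Fin n → ℂ) : ℂ :=
  (fderivWithin ℝ U K x (Pi.single j 1) - I * fderivWithin ℝ U K x (Pi.single j I)) / 2

/-- The one-form `∂U`, up to the boundary of `K`. -/
noncomputable def delWithin (K : Set (Fin n → ℂ)) (U : (Fin n → ℂ) → ℂ) (x : Fin n → ℂ) :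
    (Fin n → ℂ) →L[ℝ] ℂ :=
  ∑ j, wirtWithin K U j x • ContinuousLinearMap.proj (R := ℝ) (φ := fun _ : Fin n => ℂ) j

theorem delWithin_apply (K : Set (Fin n → ℂ)) (U : (Fin n → ℂ) → ℂ) (x v : Fin n → ℂ) :
    delWithin K U x v = ∑ j, wirtWithin K U j x * v j := by
  simp [delWithin]

theorem delWithin_single (K : Set (Fin n → ℂ)) (U : (Fin n → ℂ) → ℂ) (x : Fin n → ℂ)
    (j : Fin n) (a : ℂ) : delWithin K U x (Pi.single j a) = wirtWithin K U j x * a := by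
  rw [delWithin_apply, Finset.sum_eq_single j]
  · simp
  · intro i _ hij
    simp [hij]
  · simp

theorem contDiffOn_wirtWithin {K : Set (Fin n → ℂ)} (hK : UniqueDiffOn ℝ K)
    {U : (Fin n → ℂ) → ℂ} (hU : ContDiffOn ℝ ∞ U K) (j : Fin n) :
    ContDiffOn ℝ ∞ (wirtWithin K U j) K := by
  have h : ContDiffOn ℝ ∞ (fderivWithin ℝ U K) K := hU.fderivWithin hK (by simp)
  exact ((h.clm_apply contDiffOn_const).sub
    (contDiffOn_const.mul (h.clm_apply contDiffOn_const))).div_const 2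

theorem contDiffOn_delWithin {K : Set (Fin n → ℂ)} (hK : UniqueDiffOn ℝ K)
    {U : (Fin n → ℂ) → ℂ} (hU : ContDiffOn ℝ ∞ U K) : ContDiffOn ℝ ∞ (delWithin K U) K :=
  ContDiffOn.sum fun j _ => (contDiffOn_wirtWithin hK hU j).smul contDiffOn_const

theorem fderiv_delWithin_symmetric {K : Set (Fin n → ℂ)} {U : (Fin n → ℂ) → ℂ}
    {x : Fin n → ℂ} (hx : K ∈ 𝓝 x) (hU : ContDiffAt ℝ ∞ U x)
    (h : ∀ j k, wirt j (wirtBar k U) x = 0) (v w : Fin n → ℂ) :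
    fderiv ℝ (delWithin K U) x v w = fderiv ℝ (delWithin K U) x w v := by
  have hU2 : ContDiffAt ℝ 2 U x := hU.of_le (by norm_cast)
  have heq : ∀ j, wirtWithin K U j =ᶠ[𝓝 x] wirt j U := by
    intro j
    filter_upwards [eventually_mem_nhds_iff.2 hx] with y hy
    rw [wirtWithin, wirt, fderivWithin_of_mem_nhds hy]
  have hd : ∀ j, DifferentiableAt ℝ (wirt j U) x := by
    intro j
    have h1 := hasFDerivAt_fderiv_apply hU2
    exact (((h1 (Pi.single j 1)).sub
      ((h1 (Pi.single j I)).const_mul I)).mul_const (2⁻¹ : ℂ)).differentiableAt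
  have hD : HasFDerivAt (delWithin K U) _ x := HasFDerivAt.fun_sum (u := Finset.univ) fun j _ =>
    ((hd j).hasFDerivAt.congr_of_eventuallyEq (heq j)).smul_const
      (ContinuousLinearMap.proj (R := ℝ) (φ := fun _ : Fin n => ℂ) j)
  have hDv : ∀ v w, fderiv ℝ (delWithin K U) x v w =
      ∑ j, ∑ k, v k * w j * wirt k (wirt j U) x := by
    intro v w
    rw [hD.fderiv]
    simp only [sum_apply, ContinuousLinearMap.smulRight_apply, smul_apply,
      ContinuousLinearMap.proj_apply, smul_eq_mul]
    refine Finset.sum_congr rfl fun j _ => ?_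
    rw [fderiv_eq_sum_wirt, Finset.sum_mul]
    refine Finset.sum_congr rfl fun k _ => ?_
    rw [← wirt_wirtBar_comm hU2, h]
    ring
  rw [hDv, hDv, Finset.sum_comm]
  refine Finset.sum_congr rfl fun j _ => Finset.sum_congr rfl fun k _ => ?_
  rw [wirt_comm hU2]
  ring

theorem fderiv_eq_fderivWithin_of_tangent {E F : Type*} [NormedAddCommGroup E] [NormedSpace ℝ E]
    [FiniteDimensional ℝ E] [NormedAddCommGroup F] [NormedSpace ℝ F] {ρ : E → ℝ}
    (hρ : ContDiff ℝ ∞ ρ) {K : Set E} (hK : ∀ x, ρ x = 0 → x ∈ K) {u U : E → F} {p v : E}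
    (hp₀ : ρ p = 0) (hp : fderiv ℝ ρ p ≠ 0) (hU : DifferentiableWithinAt ℝ U K p)
    (hu : DifferentiableAt ℝ u p) (h : ∀ x, ρ x = 0 → U x = u x) (hv : fderiv ℝ ρ p v = 0) :
    fderiv ℝ u p v = fderivWithin ℝ U K p v := by
  obtain ⟨ε, hε, r, hr, hr₀, hrid, hrv⟩ := exists_smooth_retraction hρ hp₀ hp
  have hpb : ball p ε ∈ 𝓝 p := ball_mem_nhds p hε
  have hrp : r p = p := hrid p (mem_ball_self hε) hp₀
  have hrd : HasFDerivAt r (fderiv ℝ r p) p :=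
    ((hr.contDiffAt hpb).differentiableAt (by simp)).hasFDerivAt
  have h1 : HasFDerivAt (u ∘ r) ((fderiv ℝ u p).comp (fderiv ℝ r p)) p :=
    HasFDerivAt.comp p (by rw [hrp]; exact hu.hasFDerivAt) hrd
  have h2 : HasFDerivAt (U ∘ r) ((fderivWithin ℝ U K p).comp (fderiv ℝ r p)) p :=
    HasFDerivWithinAt.comp_hasFDerivAt (t := K) p (by rw [hrp]; exact hU.hasFDerivWithinAt) hrd
      (by filter_upwards [hpb] with x hx using hK _ (hr₀ x hx))
  have h3 : U ∘ r =ᶠ[𝓝 p] u ∘ r := by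
    filter_upwards [hpb] with x hx using h _ (hr₀ x hx)
  have h4 := DFunLike.congr_fun (h1.unique (h2.congr_of_eventuallyEq h3.symm)) v
  simpa [hrv v hv] using h4

/-- The boundary values of a pluriharmonic function which is smooth up to the boundary are the sum
of a CR function and a conjugate-CR function. -/
theorem exists_isCROn_add_conj {ρ : (Fin n → ℂ) → ℝ} (hρ : ContDiff ℝ ∞ ρ)
    (hreg : ∀ x, ρ x = 0 → fderiv ℝ ρ x ≠ 0) (hsc : SimplyConnectedSpace {x | ρ x = 0})
    {u U : (Fin n → ℂ) → ℂ} (hu : ContDiff ℝ ∞ u)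
    (hU : ContDiffOn ℝ ∞ U (closure {x | ρ x < 0}))
    (hpl : ∀ x, ρ x < 0 → ∀ j k, wirt j (fun y => wirtBar k U y) x = 0)
    (hUu : ∀ x, ρ x = 0 → U x = u x) :
    ∃ f g : (Fin n → ℂ) → ℂ, ContDiff ℝ ∞ f ∧ ContDiff ℝ ∞ g ∧ IsCROn ρ {x | ρ x = 0} f ∧
      IsCROn ρ {x | ρ x = 0} (fun y => conj (g y)) ∧ ∀ x, u x = f x + g x := by
  set K := closure {x | ρ x < 0} with hKdef
  have hΩ : IsOpen {x | ρ x < 0} := isOpen_lt hρ.continuous continuous_const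
  have hK := uniqueDiffOn_closure_neg (hρ.differentiable (by simp)) hreg
  have hSK : ∀ x, ρ x = 0 → x ∈ K := fun x hx => mem_closure_neg hx (hreg x hx)
  obtain ⟨f, hf, hfω⟩ := exists_tangential_primitive hρ hreg hsc (contDiffOn_delWithin hK hU)
    fun x hx => by
      have hxK : K ∈ 𝓝 x := mem_of_superset (hΩ.mem_nhds hx) subset_closure
      exact fderiv_delWithin_symmetric hxK (hU.contDiffAt hxK) (hpl x hx)
  have hfd := hf.differentiable (by simp)
  have hud := hu.differentiable (by simp)
  have hρd := hρ.differentiable (by simp)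
  have hfc : ∀ p, ρ p = 0 → ∃ c : ℂ, ∀ v,
      fderiv ℝ f p v = delWithin K U p v + c * fderiv ℝ ρ p v := by
    intro p hp
    obtain ⟨c, hc⟩ := exists_eq_mul_of_ker (hreg p hp) (fderiv ℝ f p - delWithin K U p)
      fun v hv => by rw [sub_apply, hfω p hp v hv, sub_self]
    exact ⟨c, fun v => by rw [← hc, sub_apply, add_sub_cancel]⟩
  have huc : ∀ p, ρ p = 0 → ∃ c : ℂ, ∀ v,
      fderiv ℝ u p v = fderivWithin ℝ U K p v + c * fderiv ℝ ρ p v := by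
    intro p hp
    obtain ⟨c, hc⟩ := exists_eq_mul_of_ker (hreg p hp) (fderiv ℝ u p - fderivWithin ℝ U K p)
      fun v hv => by
        rw [sub_apply, fderiv_eq_fderivWithin_of_tangent hρ hSK hp (hreg p hp)
          (hU.differentiableOn (by simp) p (hSK p hp)) (hud p) hUu hv, sub_self]
    exact ⟨c, fun v => by rw [← hc, sub_apply, add_sub_cancel]⟩
  refine ⟨f, fun x => u x - f x, hf, hu.sub hf, ?_, ?_, fun x => (add_sub_cancel _ _).symm⟩
  · refine isCROn_of_forall_exists_mul fun p hp => ?_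
    obtain ⟨c, hc⟩ := hfc p hp
    refine ⟨c, fun j => ?_⟩
    simp only [wirtBar, hc, delWithin_single, fderiv_ofReal_comp (hρd p)]
    linear_combination (wirtWithin K U j p / 2) * I_sq
  · refine isCROn_of_forall_exists_mul fun p hp => ?_
    obtain ⟨c, hc⟩ := hfc p hp
    obtain ⟨d, hd⟩ := huc p hp
    refine ⟨conj (d - c), fun j => ?_⟩
    rw [wirtBar_conj, ← conj_conj (wirtBar j (fun y => (ρ y : ℂ)) p), ← wirt_ofReal_comp, ← map_mul]
    congr 1
    rw [wirt, fderiv_fun_sub (hud p) (hfd p)]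
    simp only [wirt, sub_apply, hc, hd, delWithin_single, fderiv_ofReal_comp (hρd p)]
    have h1 : wirtWithin K U j p = (fderivWithin ℝ U K p (Pi.single j 1) -
      I * fderivWithin ℝ U K p (Pi.single j I)) / 2 := rfl
    linear_combination (wirtWithin K U j p / 2) * I_sq - h1

end PluriharmonicDecomposition

/-- for a compact connected simply-connected smooth hypersurface
`S ⊂ ℂⁿ` bounding the domain `Ω`, a smooth `u : S → ℂ` extends to a smooth
function on `closure Ω` pluriharmonic in `Ω` iff `u` is the sum of a CR function
and a conjugate-CR function on `S`. -/
theorem stmt17 {n : ℕ} (hn : 2 ≤ n)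
    (ρ : (Fin n → ℂ) → ℝ) (hρ : ContDiff ℝ (⊤ : ℕ∞) ρ)
    (Ω S : Set (Fin n → ℂ))
    (hΩ : Ω = {x | ρ x < 0}) (hS : S = {x | ρ x = 0})
    (hreg : ∀ x ∈ S, fderiv ℝ ρ x ≠ 0)
    (hbdd : Bornology.IsBounded Ω) (hcpt : IsCompact S)
    (hconn : IsConnected S) (hsc : SimplyConnectedSpace S)
    (u : (Fin n → ℂ) → ℂ) (hu : ContDiff ℝ (⊤ : ℕ∞) u) :
    (∃ U : (Fin n → ℂ) → ℂ,
        ContDiffOn ℝ (⊤ : ℕ∞) U (closure Ω) ∧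
        (∀ x ∈ Ω, ∀ j k : Fin n, wirt j (fun y => wirtBar k U y) x = 0) ∧
        ∀ x ∈ S, U x = u x)
    ↔ (∃ f g : (Fin n → ℂ) → ℂ,
        ContDiff ℝ (⊤ : ℕ∞) f ∧ ContDiff ℝ (⊤ : ℕ∞) g ∧
        IsCROn ρ S f ∧
        IsCROn ρ S (fun y => conj (g y)) ∧
        ∀ x ∈ S, u x = f x + g x) := by
  subst hΩ hS
  constructor
  · rintro ⟨U, hU, hpl, hUu⟩
    obtain ⟨f, g, hf, hg, hfCR, hgCR, h⟩ := exists_isCROn_add_conj hρ hreg hsc hu hU hpl hUu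
    exact ⟨f, g, hf, hg, hfCR, hgCR, fun x _ => h x⟩
  · rintro ⟨f, g, hf, hg, hfCR, hgCR, h⟩
    obtain ⟨U, hU, hpl, hUu⟩ := exists_pluriharmonic_extension hn hρ hreg hbdd hconn hf hg hfCR hgCR
    exact ⟨U, hU, hpl, fun x hx => (hUu x hx).trans (h x hx).symm⟩
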